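/- Fix p > 2 and let (ω,u) be a smooth solution of the vorticity form of the 2D incompressible Euler equations on ℍ with nonnegative, compactly supported initial vorticity ω₀ = ω(0,·). Define the rescalings ω̃(t,y) = t² ω(t, ty) and ũ(t,y) = t u(t, ty). Suppose t_k → ∞ is a sequence of times such that ω̃(t_k,·) converges weak-* to μ ⊗ δ₀, i.e. ∫_ℍ φ(y) ω̃(t_k,y) dy → ∫_ℝ φ(s,0) dμ(s) for every bounded continuous φ on the closed half-plane, where μ is a finite nonnegative measure on ℝ with decomposition μ = ν + Σ_i m_i δ_{α_i} into its continuous part ν and its atoms m_i > 0 at distinct points α_i. Then there exists a constant D > 0, depending only on p, such that for every bounded continuous ψ : ℝ → ℝ, limsup_{k→∞} |∫_ℍ ψ(y₁) (ũ₁(t_k,y)/t_k) ω̃(t_k,y) dy| ≤ D · ‖ω₀‖_{L^p}^{p′/2} · Σ_i m_i^{2 − p′/2} |ψ(α_i)|. -/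

import Mathlib

open MeasureTheory

/-- The Euclidean norm on `ℝ × ℝ`. -/
noncomputable def nrm (z : ℝ × ℝ) : ℝ := Real.sqrt (z.1 ^ 2 + z.2 ^ 2)

/-- The upper half-plane `ℍ = {x ∈ ℝ² : x₂ > 0}`. -/
def Hplane : Set (ℝ × ℝ) := {x | 0 < x.2}

/-- Reflection `x̄ = (x₁, -x₂)`. -/
def pbar (z : ℝ × ℝ) : ℝ × ℝ := (z.1, -z.2)

/-- Perpendicular vector `z^⊥ = (-z₂, z₁)`. -/
def perp (z : ℝ × ℝ) : ℝ × ℝ := (-z.2, z.1)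

/-- The half-plane Biot–Savart kernel
`K(x,y) = (x-y)^⊥/(2π|x-y|²) - (x-ȳ)^⊥/(2π|x-ȳ|²)`. -/
noncomputable def Kker (x y : ℝ × ℝ) : ℝ × ℝ :=
  (2 * Real.pi * nrm (x - y) ^ 2)⁻¹ • perp (x - y) -
    (2 * Real.pi * nrm (x - pbar y) ^ 2)⁻¹ • perp (x - pbar y)

/-- A smooth solution of the vorticity form of the 2D incompressible Euler
equations on the half-plane `ℍ`: `ω` is smooth, compactly supported in `ℍ`
at each time, transported by the velocity `u` recovered from `ω` by the
half-plane Biot–Savart law. -/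
structure IsEulerSol (ω : ℝ → ℝ × ℝ → ℝ) (u : ℝ → ℝ × ℝ → ℝ × ℝ) : Prop where
  smooth : ContDiff ℝ (⊤ : ℕ∞) (fun q : ℝ × (ℝ × ℝ) => ω q.1 q.2)
  compactSupp : ∀ t, HasCompactSupport (ω t)
  suppIn : ∀ t, tsupport (ω t) ⊆ Hplane
  biotSavart : ∀ t x, u t x = ∫ y in Hplane, ω t y • Kker x y
  transport : ∀ t, 0 ≤ t → ∀ x ∈ Hplane,
    deriv (fun s => ω s x) t + fderiv ℝ (ω t) x (u t x) = 0

open Filter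

/-- The rescaled vorticity `ω̃(t,y) = t² ω(t, ty)`. -/
noncomputable def rescVort (ω : ℝ → ℝ × ℝ → ℝ) (t : ℝ) (y : ℝ × ℝ) : ℝ :=
  t ^ 2 * ω t (t • y)

/-- The rescaled velocity `ũ(t,y) = t u(t, ty)`. -/
noncomputable def rescVel (u : ℝ → ℝ × ℝ → ℝ × ℝ) (t : ℝ) (y : ℝ × ℝ) : ℝ × ℝ :=
  t • u t (t • y)

section
open Set Metric

lemma integrableOn_ball_norm_rpow {q : ℝ} (hq : q < 2) (r : ℝ) :
    IntegrableOn (fun z : ℝ × ℝ => ‖z‖ ^ (-q)) (ball 0 r) := by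
  rcases le_or_gt r 0 with hr | hr
  · simp [ball_eq_empty.2 hr]
  rw [integrableOn_fun_norm_addHaar volume (f := fun s => s ^ (-q))]
  have h : IntegrableOn (fun s : ℝ => s ^ (1 - q)) (Ioo 0 r) := by
    rw [intervalIntegral.integrableOn_Ioo_rpow_iff hr]
    linarith
  refine h.congr_fun (fun y hy => ?_) measurableSet_Ioo
  simp only [Module.finrank_prod, Module.finrank_self, smul_eq_mul]
  rw [sub_eq_add_neg, Real.rpow_add hy.1, Real.rpow_one]
  norm_num

lemma integral_ball_norm_rpow (q : ℝ) {r : ℝ} (hr : 0 < r) :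
    ∫ z in ball (0 : ℝ × ℝ) r, ‖z‖ ^ (-q) =
      r ^ (2 - q) * ∫ z in ball (0 : ℝ × ℝ) 1, ‖z‖ ^ (-q) := by
  have h := Measure.setIntegral_comp_smul_of_pos (volume : Measure (ℝ × ℝ))
    (fun z => ‖z‖ ^ (-q)) (ball 0 1) hr
  rw [_root_.smul_ball hr.ne'] at h
  simp only [smul_zero, Real.norm_of_nonneg hr.le, mul_one, Module.finrank_prod,
    Module.finrank_self, smul_eq_mul, norm_smul] at h
  simp only [Real.mul_rpow hr.le (norm_nonneg _), integral_const_mul] at h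
  have h2 : r ^ (2 - q) = r ^ 2 * r ^ (-q) := by
    rw [sub_eq_add_neg, Real.rpow_add hr]; norm_num
  rw [h2, mul_assoc, h]
  field_simp

/-- An integrable majorant for the Biot–Savart kernel in Young's inequality. -/
noncomputable def youngKernel (q : ℝ) (z : ℝ × ℝ) : ℝ :=
  (ball (0 : ℝ × ℝ) 1).indicator (fun z => ‖z‖ ^ (-q)) z + 8 * (1 + ‖z‖) ^ (-3 : ℝ)

lemma integrable_youngKernel {q : ℝ} (hq : q < 2) : Integrable (youngKernel q) := by
  refine ((integrable_indicator_iff measurableSet_ball).2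
    (integrableOn_ball_norm_rpow hq 1)).add ((integrable_one_add_norm ?_).const_mul 8)
  simp; norm_num

lemma youngKernel_nonneg (q : ℝ) (z : ℝ × ℝ) : 0 ≤ youngKernel q z :=
  add_nonneg (indicator_nonneg (fun _ _ => by positivity) _) (by positivity)

lemma abs_mul_norm_inv_le {p q : ℝ} (hpq : p.HolderConjugate q) (s : ℝ) (z : ℝ × ℝ) :
    |s| * ‖z‖⁻¹ ≤ |s| ^ (3 / 2 : ℝ) + |s| ^ p + youngKernel q z := by
  have h1 := hpq.lt
  have h2 := hpq.symm.lt
  unfold youngKernel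
  by_cases hz : ‖z‖ < 1
  · rw [indicator_of_mem (by simpa using hz)]
    have h := Real.young_inequality_of_nonneg (abs_nonneg s) (inv_nonneg.2 (norm_nonneg z)) hpq
    have h3 : |s| ^ p / p ≤ |s| ^ p := div_le_self (by positivity) h1.le
    have h4 : ‖z‖⁻¹ ^ q / q ≤ ‖z‖ ^ (-q) := by
      rw [Real.rpow_neg_eq_inv_rpow]; exact div_le_self (by positivity) h2.le
    have : 0 ≤ |s| ^ (3 / 2 : ℝ) := by positivity
    have : 0 ≤ 8 * (1 + ‖z‖) ^ (-3 : ℝ) := by positivity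
    linarith
  · rw [indicator_of_notMem (by simpa using hz)]
    push Not at hz
    have h := Real.young_inequality_of_nonneg (abs_nonneg s) (inv_nonneg.2 (norm_nonneg z))
      (p := 3 / 2) (q := 3) ⟨by norm_num, by norm_num, by norm_num⟩
    have h3 : |s| ^ (3 / 2 : ℝ) / (3 / 2) ≤ |s| ^ (3 / 2 : ℝ) :=
      div_le_self (by positivity) (by norm_num)
    have h4 : ‖z‖⁻¹ ^ (3 : ℝ) / 3 ≤ 8 * (1 + ‖z‖) ^ (-3 : ℝ) := by
      refine (div_le_self (by positivity) (by norm_num)).trans ?_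
      rw [Real.rpow_neg_eq_inv_rpow]
      have : (8 : ℝ) = 2 ^ (3 : ℝ) := by norm_num
      rw [this, ← Real.mul_rpow (by norm_num) (by positivity)]
      refine Real.rpow_le_rpow (by positivity) ?_ (by norm_num)
      rw [← div_eq_mul_inv, inv_le_comm₀ (by positivity) (by positivity), inv_div]
      linarith
    have : 0 ≤ |s| ^ p := by positivity
    linarith

lemma norm_le_nrm (z : ℝ × ℝ) : ‖z‖ ≤ nrm z := by
  rw [Prod.norm_def, nrm]
  refine max_le ?_ ?_ <;> refine Real.le_sqrt_of_sq_le ?_ <;> rw [Real.norm_eq_abs, sq_abs] <;>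
    nlinarith [sq_nonneg z.1, sq_nonneg z.2]

/-- The Biot–Savart kernel of the whole plane. -/
noncomputable def planeKernel (z : ℝ × ℝ) : ℝ × ℝ := (2 * Real.pi * nrm z ^ 2)⁻¹ • perp z

lemma Kker_eq (x y : ℝ × ℝ) : Kker x y = planeKernel (x - y) - planeKernel (x - pbar y) := rfl

lemma norm_perp (z : ℝ × ℝ) : ‖perp z‖ = ‖z‖ := by
  simp [perp, Prod.norm_def, max_comm]

lemma norm_planeKernel_le (z : ℝ × ℝ) : ‖planeKernel z‖ ≤ (2 * Real.pi)⁻¹ * ‖z‖⁻¹ := by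
  rw [planeKernel, norm_smul, norm_perp, norm_inv]
  rcases eq_or_ne z 0 with rfl | hz
  · simp
  have h1 : 0 < ‖z‖ := norm_pos_iff.2 hz
  have h2 := norm_le_nrm z
  have h3 : 0 < nrm z := h1.trans_le h2
  rw [Real.norm_of_nonneg (by positivity), ← div_eq_inv_mul, ← mul_inv, ← one_div,
    div_le_div_iff₀ (by positivity) (by positivity)]
  have : ‖z‖ ^ 2 ≤ nrm z ^ 2 := by gcongr
  nlinarith [Real.pi_pos]

lemma norm_planeKernel_le_inv (z : ℝ × ℝ) : ‖planeKernel z‖ ≤ ‖z‖⁻¹ := by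
  refine (norm_planeKernel_le z).trans (mul_le_of_le_one_left (by positivity) ?_)
  exact inv_le_one_of_one_le₀ (by nlinarith [Real.pi_gt_three])

lemma norm_Kker_le {x y : ℝ × ℝ} (hx : x ∈ Hplane) (hy : y ∈ Hplane) (hxy : x ≠ y) :
    ‖Kker x y‖ ≤ 2 * ‖x - y‖⁻¹ := by
  rw [Kker_eq, two_mul]
  refine (norm_sub_le _ _).trans (add_le_add (norm_planeKernel_le_inv _)
    ((norm_planeKernel_le_inv _).trans ?_))
  have : 0 < ‖x - y‖ := norm_pos_iff.2 (sub_ne_zero.2 hxy)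
  refine inv_anti₀ this ?_
  simp only [Prod.norm_def, pbar, Prod.fst_sub, Prod.snd_sub, Real.norm_eq_abs, sub_neg_eq_add]
  refine max_le_max le_rfl ?_
  rw [abs_le, abs_of_pos (add_pos hx hy)]
  simp only [Hplane, mem_ofPred_eq] at hx hy
  constructor <;> linarith

lemma measurable_planeKernel : Measurable planeKernel := by
  unfold planeKernel nrm perp; fun_prop

end

section
open Set Metric

lemma exists_fderiv_bound {h : ℝ × ℝ → ℝ} (hh : ContDiff ℝ 1 h) (hc : HasCompactSupport h) :
    ∃ C R, 0 < C ∧ 0 < R ∧ (∀ z, ‖fderiv ℝ h z‖ ≤ C) ∧ ∀ z, R ≤ ‖z‖ → fderiv ℝ h z = 0 := by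
  have hcont := hh.continuous_fderiv one_ne_zero
  have hcs := hc.fderiv (𝕜 := ℝ)
  obtain ⟨C, hC⟩ := hcont.bounded_above_of_compact_support hcs
  obtain ⟨R, hR0, hR⟩ := hcs.isCompact.isBounded.exists_pos_norm_lt
  refine ⟨max C 1, R, by positivity, hR0, fun z => (hC z).trans (le_max_left _ _), fun z hz => ?_⟩
  by_contra hne
  exact absurd (hR z (subset_tsupport _ hne)) (not_lt.2 hz)

lemma nrm_polarCoord_symm (p : ℝ × ℝ) : nrm (polarCoord.symm p) ^ 2 = p.1 ^ 2 := by
  rw [nrm, Real.sq_sqrt (by positivity), polarCoord_symm_apply]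
  nlinarith [Real.sin_sq_add_cos_sq p.2]

lemma norm_polarCoord_symm_ge (p : ℝ × ℝ) : |p.1| ≤ 2 * ‖polarCoord.symm p‖ := by
  have h := nrm_polarCoord_symm p
  set z := polarCoord.symm p
  have h1 : |z.1| ≤ ‖z‖ := norm_fst_le z
  have h2 : |z.2| ≤ ‖z‖ := norm_snd_le z
  rw [nrm, Real.sq_sqrt (by positivity)] at h
  refine abs_le_of_sq_le_sq ?_ (by positivity)
  have := sq_le_sq' (abs_le.1 h1).1 (abs_le.1 h1).2
  have := sq_le_sq' (abs_le.1 h2).1 (abs_le.1 h2).2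
  nlinarith [sq_nonneg ‖z‖]

/-- The planar Biot–Savart kernel is weakly divergence free. -/
lemma integral_fderiv_planeKernel {h : ℝ × ℝ → ℝ} (hh : ContDiff ℝ 1 h)
    (hc : HasCompactSupport h) : ∫ z, fderiv ℝ h z (planeKernel z) = 0 := by
  obtain ⟨C, R, hC, hR, hb, hz⟩ := exists_fderiv_bound hh hc
  rw [← integral_comp_polarCoord_symm, polarCoord_target]
  set g : ℝ × ℝ → ℝ := fun p =>
    (2 * Real.pi)⁻¹ * fderiv ℝ h (polarCoord.symm p) (-Real.sin p.2, Real.cos p.2) with hg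
  have hgc : Continuous g := by
    refine continuous_const.mul (Continuous.clm_apply ?_ (by fun_prop))
    exact (hh.continuous_fderiv one_ne_zero).comp continuous_polarCoord_symm
  have hg0 : ∀ p : ℝ × ℝ, 2 * R ≤ |p.1| → g p = 0 := fun p hp => by
    have := norm_polarCoord_symm_ge p
    simp only [hg, hz _ (by linarith : R ≤ ‖polarCoord.symm p‖), zero_apply,
      mul_zero]
  have hm : MeasurableSet (Ioi (0 : ℝ) ×ˢ Ioo (-Real.pi) Real.pi) :=
    measurableSet_Ioi.prod measurableSet_Ioo
  have hgi : IntegrableOn g (Ioi (0 : ℝ) ×ˢ Ioo (-Real.pi) Real.pi) := by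
    have h1 : IntegrableOn g (Icc (0 : ℝ) (2 * R) ×ˢ Icc (-Real.pi) Real.pi) :=
      hgc.continuousOn.integrableOn_compact (isCompact_Icc.prod isCompact_Icc)
    refine h1.of_forall_sdiff_eq_zero hm fun p hp => hg0 p ?_
    by_contra hlt
    push Not at hlt
    have hp1 : 0 < p.1 := hp.1.1
    exact hp.2 ⟨⟨hp1.le, (le_abs_self _).trans hlt.le⟩, Ioo_subset_Icc_self hp.1.2⟩
  have hEq : ∀ p ∈ Ioi (0 : ℝ) ×ˢ Ioo (-Real.pi) Real.pi,
      p.1 • fderiv ℝ h (polarCoord.symm p) (planeKernel (polarCoord.symm p)) = g p := fun p hp => by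
    have hp1 : 0 < p.1 := hp.1
    rw [planeKernel, nrm_polarCoord_symm, map_smul]
    have : perp (polarCoord.symm p) = p.1 • (-Real.sin p.2, Real.cos p.2) := by
      simp [perp, polarCoord_symm_apply]
    rw [this, map_smul, hg]
    simp only [smul_eq_mul]
    field_simp
  rw [setIntegral_congr_fun hm hEq, Measure.volume_eq_prod, setIntegral_prod _ hgi]
  refine (setIntegral_congr_fun measurableSet_Ioi fun r hr => ?_).trans (integral_zero' _ _)
  have hr0 : (0 : ℝ) < r := hr
  rw [← integral_Ioc_eq_integral_Ioo, ← intervalIntegral.integral_of_le (by linarith [Real.pi_pos])]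
  have hder : ∀ θ : ℝ, HasDerivAt
      (fun θ => (2 * Real.pi * r)⁻¹ * h (polarCoord.symm (r, θ))) (g (r, θ)) θ := fun θ => by
    have hd : HasFDerivAt h (fderiv ℝ h (polarCoord.symm (r, θ))) (polarCoord.symm (r, θ)) :=
      (hh.differentiable one_ne_zero _).hasFDerivAt
    have hp : HasDerivAt (fun θ : ℝ => polarCoord.symm (r, θ))
        (r * -Real.sin θ, r * Real.cos θ) θ := by
      exact ((Real.hasDerivAt_cos θ).const_mul r).prodMk ((Real.hasDerivAt_sin θ).const_mul r)
    have h3 := (hd.comp_hasDerivAt θ hp).const_mul (2 * Real.pi * r)⁻¹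
    have : (r * -Real.sin θ, r * Real.cos θ) = r • (-Real.sin θ, Real.cos θ) := by simp
    rw [this, map_smul] at h3
    refine h3.congr_deriv ?_
    simp only [hg, smul_eq_mul]
    field_simp
  rw [intervalIntegral.integral_eq_sub_of_hasDerivAt (fun θ _ => hder θ)
    ((hgc.comp (by fun_prop : Continuous fun θ : ℝ => (r, θ))).intervalIntegrable _ _)]
  simp [polarCoord_symm_apply]

/-- The planar Biot–Savart velocity of a vorticity `f`. -/
noncomputable def planeVel (f : ℝ × ℝ → ℝ) (x : ℝ × ℝ) : ℝ × ℝ :=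
  ∫ y, f y • planeKernel (x - y)

variable {f : ℝ × ℝ → ℝ}

lemma integrable_abs_rpow (hf : Continuous f) (hc : HasCompactSupport f) {p : ℝ} (hp : 0 < p) :
    Integrable (fun y => |f y| ^ p) := by
  refine (hf.abs.rpow_const fun _ => Or.inr hp.le).integrable_of_hasCompactSupport ?_
  exact hc.comp_left (g := fun s => |s| ^ p) (by simp [hp.ne'])

lemma norm_smul_planeKernel_le {p q : ℝ} (hpq : p.HolderConjugate q) (s : ℝ) (z : ℝ × ℝ) :
    ‖s • planeKernel z‖ ≤ |s| ^ (3 / 2 : ℝ) + |s| ^ p + youngKernel q z := by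
  rw [norm_smul, Real.norm_eq_abs]
  exact (mul_le_mul_of_nonneg_left (norm_planeKernel_le_inv z) (abs_nonneg _)).trans
    (abs_mul_norm_inv_le hpq s z)

lemma integrable_smul_planeKernel (hf : Continuous f) (hc : HasCompactSupport f) (x : ℝ × ℝ) :
    Integrable (fun y => f y • planeKernel (x - y)) := by
  have hpq : (3 : ℝ).HolderConjugate (3 / 2) := ⟨by norm_num, by norm_num, by norm_num⟩
  refine Integrable.mono' (((integrable_abs_rpow hf hc (p := 3 / 2) (by norm_num)).add
    (integrable_abs_rpow hf hc (p := 3) (by norm_num))).add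
    ((integrable_youngKernel (q := 3 / 2) (by norm_num)).comp_sub_left x)) ?_
    (.of_forall fun y => norm_smul_planeKernel_le hpq (f y) (x - y))
  exact (hf.measurable.smul (measurable_planeKernel.comp (by fun_prop))).aestronglyMeasurable

lemma norm_planeVel_le (hf : Continuous f) (hc : HasCompactSupport f) {p q : ℝ}
    (hpq : p.HolderConjugate q) (hq : q < 2) (x : ℝ × ℝ) :
    ‖planeVel f x‖ ≤ (∫ y, (|f y| ^ (3 / 2 : ℝ) + |f y| ^ p)) + ∫ z, youngKernel q z := by
  have h1 := (integrable_abs_rpow hf hc (p := 3 / 2) (by norm_num)).add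
    (integrable_abs_rpow hf hc hpq.pos)
  have h2 := (integrable_youngKernel hq).comp_sub_left x
  refine (norm_integral_le_of_norm_le (h1.add h2)
    (.of_forall fun y => norm_smul_planeKernel_le hpq (f y) (x - y))).trans_eq ?_
  rw [integral_add' h1 h2, integral_sub_left_eq_self]
  rfl

lemma integrable_fderiv_smul_planeKernel (hf : Continuous f) (hc : HasCompactSupport f)
    {g : ℝ × ℝ → ℝ} (hg : ContDiff ℝ 1 g) (hgc : HasCompactSupport g) :
    Integrable (fun z : (ℝ × ℝ) × (ℝ × ℝ) => fderiv ℝ g z.1 (f z.2 • planeKernel (z.1 - z.2)))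
      (volume.prod volume) := by
  have hpq : (3 : ℝ).HolderConjugate (3 / 2) := ⟨by norm_num, by norm_num, by norm_num⟩
  have hG : Integrable (fun x => ‖fderiv ℝ g x‖) :=
    ((hg.continuous_fderiv one_ne_zero).integrable_of_hasCompactSupport (hgc.fderiv (𝕜 := ℝ))).norm
  have h1 := (integrable_abs_rpow hf hc (p := 3 / 2) (by norm_num)).add
    (integrable_abs_rpow hf hc (p := 3) (by norm_num))
  have h2 := ((Integrable.convolution_integrand (ContinuousLinearMap.mul ℝ ℝ) hG
    (integrable_youngKernel (q := 3 / 2) (by norm_num)).comp_neg)).swap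
  refine Integrable.mono' ((hG.mul_prod h1).add h2) ?_ (.of_forall fun z => ?_)
  · refine Measurable.aestronglyMeasurable ?_
    exact isBoundedBilinearMap_apply.continuous.measurable.comp
      (((hg.continuous_fderiv one_ne_zero).measurable.comp measurable_fst).prodMk
      ((hf.measurable.comp measurable_snd).smul
        (measurable_planeKernel.comp (measurable_fst.sub measurable_snd))))
  · refine (ContinuousLinearMap.le_opNorm _ _).trans ((mul_le_mul_of_nonneg_left
      (norm_smul_planeKernel_le hpq (f z.2) (z.1 - z.2)) (norm_nonneg _)).trans_eq ?_)
    simp [mul_add]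

/-- The planar Biot–Savart velocity is weakly divergence free. -/
lemma integral_fderiv_planeVel (hf : Continuous f) (hc : HasCompactSupport f)
    {g : ℝ × ℝ → ℝ} (hg : ContDiff ℝ 1 g) (hgc : HasCompactSupport g) :
    Integrable (fun x => fderiv ℝ g x (planeVel f x)) ∧
      ∫ x, fderiv ℝ g x (planeVel f x) = 0 := by
  have hi := integrable_fderiv_smul_planeKernel hf hc hg hgc
  have heq : (fun x => fderiv ℝ g x (planeVel f x)) =
      fun x => ∫ y, fderiv ℝ g x (f y • planeKernel (x - y)) := by
    ext x
    exact (ContinuousLinearMap.integral_comp_comm _ (integrable_smul_planeKernel hf hc x)).symm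
  rw [heq]
  refine ⟨hi.integral_prod_left, ?_⟩
  rw [integral_integral_swap hi]
  refine (integral_congr_ae (.of_forall fun y => ?_)).trans (integral_zero' _ _)
  simp only [map_smul, integral_smul, Pi.zero_apply]
  rw [← integral_add_right_eq_self _ y]
  simp only [add_sub_cancel_right]
  have h := integral_fderiv_planeKernel (h := fun x => g (x + y)) (by fun_prop)
    (hgc.comp_homeomorph (Homeomorph.addRight y))
  simp only [fderiv_comp_add_right] at h
  rw [h, smul_zero]

end

section
open Set Metric Topology

lemma hasDerivAt_integral_of_contDiff {G : ℝ × (ℝ × ℝ) → ℝ} (hG : ContDiff ℝ 1 G)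
    {K : Set (ℝ × ℝ)} (hK : IsCompact K) (h0 : ∀ s, ∀ x ∉ K, G (s, x) = 0) (t : ℝ) :
    Integrable (fun x => fderiv ℝ G (t, x) (1, 0)) ∧
      HasDerivAt (fun s => ∫ x, G (s, x)) (∫ x, fderiv ℝ G (t, x) (1, 0)) t := by
  have hder : ∀ s x, HasDerivAt (fun s => G (s, x)) (fderiv ℝ G (s, x) (1, 0)) s := fun s x => by
    have hd : HasFDerivAt G (fderiv ℝ G (s, x)) (s, x) :=
      (hG.differentiable one_ne_zero _).hasFDerivAt
    exact hd.comp_hasDerivAt s ((hasDerivAt_id s).prodMk (hasDerivAt_const s x))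
  have hcont : Continuous fun q : ℝ × (ℝ × ℝ) => fderiv ℝ G q (1, 0) :=
    (hG.continuous_fderiv one_ne_zero).clm_apply continuous_const
  obtain ⟨C, hC⟩ := ((isCompact_Icc (a := t - 1) (b := t + 1)).prod hK).exists_bound_of_continuousOn
    hcont.continuousOn
  have hzero : ∀ s, ∀ x ∉ K, fderiv ℝ G (s, x) (1, 0) = 0 := fun s x hx => by
    have := hder s x
    simp only [h0 _ x hx] at this
    exact this.unique (hasDerivAt_const s 0)
  refine hasDerivAt_integral_of_dominated_loc_of_deriv_le (F := fun s x => G (s, x))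
    (F' := fun s x => fderiv ℝ G (s, x) (1, 0)) (bound := K.indicator fun _ => C)
    (s := Icc (t - 1) (t + 1)) (Icc_mem_nhds (by linarith) (by linarith)) ?_ ?_ ?_ ?_ ?_ ?_
  · exact .of_forall fun s =>
      (hG.continuous.comp (by fun_prop : Continuous fun x => (s, x))).aestronglyMeasurable
  · exact (hG.continuous.comp (by fun_prop : Continuous fun x => (t, x))).integrable_of_hasCompactSupport
      (HasCompactSupport.intro hK (h0 t))
  · exact (hcont.comp (by fun_prop : Continuous fun x => (t, x))).aestronglyMeasurable
  · refine .of_forall fun x s hs => ?_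
    by_cases hx : x ∈ K
    · rw [indicator_of_mem hx]; exact hC (s, x) ⟨hs, hx⟩
    · simp [hzero s x hx, hx]
  · exact (integrable_indicator_iff hK.measurableSet).2 (integrableOn_const hK.measure_lt_top.ne)
  · exact .of_forall fun x s _ => hder s x

lemma measurePreserving_pbar : MeasurePreserving pbar (volume : Measure (ℝ × ℝ)) volume :=
  (MeasurePreserving.id volume).prod (Measure.measurePreserving_neg volume)

lemma pbar_pbar (z : ℝ × ℝ) : pbar (pbar z) = z := by simp [pbar]

lemma continuous_pbar : Continuous pbar := by unfold pbar; fun_prop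

/-- The reflection as a homeomorphism. -/
def pbarHomeo : (ℝ × ℝ) ≃ₜ (ℝ × ℝ) where
  toFun := pbar
  invFun := pbar
  left_inv := pbar_pbar
  right_inv := pbar_pbar
  continuous_toFun := continuous_pbar
  continuous_invFun := continuous_pbar

lemma integral_comp_pbar {E : Type*} [NormedAddCommGroup E] [NormedSpace ℝ E] (f : ℝ × ℝ → E) :
    ∫ z, f (pbar z) = ∫ z, f z :=
  measurePreserving_pbar.integral_comp pbarHomeo.measurableEmbedding f

namespace IsEulerSol

variable {ω : ℝ → ℝ × ℝ → ℝ} {u : ℝ → ℝ × ℝ → ℝ × ℝ}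

lemma contDiff_slice (h : IsEulerSol ω u) (t : ℝ) : ContDiff ℝ (⊤ : ℕ∞) (ω t) :=
  h.smooth.comp (by fun_prop : ContDiff ℝ (⊤ : ℕ∞) fun x : ℝ × ℝ => (t, x))

lemma continuous_slice (h : IsEulerSol ω u) (t : ℝ) : Continuous (ω t) :=
  (h.contDiff_slice t).continuous

lemma eq_zero_of_notMem (h : IsEulerSol ω u) (t : ℝ) {x : ℝ × ℝ} (hx : x ∉ Hplane) : ω t x = 0 :=
  image_eq_zero_of_notMem_tsupport fun hx' => hx (h.suppIn t hx')

lemma vel_eq (h : IsEulerSol ω u) (t : ℝ) (x : ℝ × ℝ) :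
    u t x = planeVel (ω t) x - planeVel (ω t ∘ pbar) x := by
  have hp : planeVel (ω t ∘ pbar) x = ∫ y, ω t y • planeKernel (x - pbar y) := by
    rw [planeVel, ← integral_comp_pbar]
    simp [pbar_pbar]
  have hi := integrable_smul_planeKernel (h.continuous_slice t) (h.compactSupp t) x
  have hi' := integrable_smul_planeKernel ((h.continuous_slice t).comp continuous_pbar)
    ((h.compactSupp t).comp_homeomorph pbarHomeo) x
  rw [← (measurePreserving_pbar.integrable_comp_emb pbarHomeo.measurableEmbedding)] at hi'
  simp only [Function.comp_def, pbar_pbar] at hi'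
  rw [h.biotSavart, hp, planeVel, ← integral_sub hi hi',
    setIntegral_eq_integral_of_forall_compl_eq_zero]
  · simp only [Kker_eq, smul_sub]
  · intro y hy
    rw [h.eq_zero_of_notMem t hy, zero_smul]

lemma norm_vel_le (h : IsEulerSol ω u) {p q : ℝ} (hpq : p.HolderConjugate q) (hq : q < 2)
    (t : ℝ) (x : ℝ × ℝ) :
    ‖u t x‖ ≤ 2 * ((∫ y, (|ω t y| ^ (3 / 2 : ℝ) + |ω t y| ^ p)) + ∫ z, youngKernel q z) := by
  rw [h.vel_eq, two_mul]
  refine (norm_sub_le _ _).trans (add_le_add (norm_planeVel_le (h.continuous_slice t)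
    (h.compactSupp t) hpq hq x) ((norm_planeVel_le ((h.continuous_slice t).comp continuous_pbar)
    ((h.compactSupp t).comp_homeomorph pbarHomeo) hpq hq x).trans_eq ?_))
  rw [← integral_comp_pbar fun y => |ω t y| ^ (3 / 2 : ℝ) + |ω t y| ^ p]
  rfl

lemma integral_fderiv_vel (h : IsEulerSol ω u) (t : ℝ) {g : ℝ × ℝ → ℝ} (hg : ContDiff ℝ 1 g)
    (hgc : HasCompactSupport g) :
    Integrable (fun x => fderiv ℝ g x (u t x)) ∧ ∫ x, fderiv ℝ g x (u t x) = 0 := by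
  simp only [h.vel_eq, map_sub]
  obtain ⟨h1, h2⟩ := integral_fderiv_planeVel (h.continuous_slice t) (h.compactSupp t) hg hgc
  obtain ⟨h3, h4⟩ := integral_fderiv_planeVel ((h.continuous_slice t).comp continuous_pbar)
    ((h.compactSupp t).comp_homeomorph pbarHomeo) hg hgc
  exact ⟨h1.sub h3, by rw [integral_sub h1 h3, h2, h4, sub_zero]⟩

lemma fderiv_transport (h : IsEulerSol ω u) {t : ℝ} (ht : 0 ≤ t) (x : ℝ × ℝ) :
    fderiv ℝ (fun q : ℝ × (ℝ × ℝ) => ω q.1 q.2) (t, x) (1, u t x) = 0 := by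
  have hd : HasFDerivAt (fun q : ℝ × (ℝ × ℝ) => ω q.1 q.2)
      (fderiv ℝ (fun q : ℝ × (ℝ × ℝ) => ω q.1 q.2) (t, x)) (t, x) :=
    (h.smooth.differentiable (by simp) _).hasFDerivAt
  set L := fderiv ℝ (fun q : ℝ × (ℝ × ℝ) => ω q.1 q.2) (t, x)
  have h1 : HasDerivAt (fun s => ω s x) (L (1, 0)) t := by
    have h1' := hd.comp_hasDerivAt t ((hasDerivAt_id t).prodMk (hasDerivAt_const t x))
    exact h1'
  have h2 : HasFDerivAt (ω t) (L.comp (.inr ℝ ℝ (ℝ × ℝ))) x :=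
    hd.comp x (hasFDerivAt_prodMk_right t x)
  have h3 : L (1, u t x) = deriv (fun s => ω s x) t + fderiv ℝ (ω t) x (u t x) := by
    rw [h1.deriv, h2.fderiv, ContinuousLinearMap.comp_apply, ContinuousLinearMap.inr_apply,
      ← map_add]
    simp
  rw [h3]
  by_cases hx : x ∈ Hplane
  · exact h.transport t ht x hx
  · have h4 : (fun s => ω s x) = fun _ => 0 := funext fun s => h.eq_zero_of_notMem s hx
    have h5 : fderiv ℝ (ω t) x = 0 := by
      by_contra hne
      exact hx (h.suppIn t (support_fderiv_subset ℝ hne))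
    simp [h4, h5]

lemma hasDerivAt_truncated (h : IsEulerSol ω u) {F : ℝ → ℝ} (hF : ContDiff ℝ 1 F)
    {χ : ℝ × ℝ → ℝ} (hχ : ContDiff ℝ 1 χ) (hχc : HasCompactSupport χ) {t : ℝ} (ht : 0 ≤ t) :
    HasDerivAt (fun s => ∫ x, F (ω s x) * χ x) (∫ x, F (ω t x) * fderiv ℝ χ x (u t x)) t := by
  have hs : ContDiff ℝ 1 (fun q : ℝ × (ℝ × ℝ) => ω q.1 q.2) := h.smooth.of_le (by simp)
  have hG : ContDiff ℝ 1 (fun q : ℝ × (ℝ × ℝ) => F (ω q.1 q.2) * χ q.2) :=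
    (hF.comp hs).mul (hχ.comp contDiff_snd)
  set G : ℝ × (ℝ × ℝ) → ℝ := fun q => F (ω q.1 q.2) * χ q.2 with hGdef
  obtain ⟨hi, hd⟩ := hasDerivAt_integral_of_contDiff hG hχc.isCompact
    (fun s x hx => by simp [hGdef, image_eq_zero_of_notMem_tsupport hx]) t
  refine hd.congr_deriv ?_
  have hg : ContDiff ℝ 1 (fun x => G (t, x)) := hG.comp (by fun_prop)
  obtain ⟨hi2, hz⟩ := h.integral_fderiv_vel t hg (hχc.mul_left (f := fun x => F (ω t x)))
  rw [← add_zero (∫ x, fderiv ℝ G (t, x) (1, 0)), ← hz, ← integral_add hi hi2]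
  refine integral_congr_ae (.of_forall fun x => ?_)
  have hGd : HasFDerivAt G (fderiv ℝ G (t, x)) (t, x) :=
    (hG.differentiable one_ne_zero _).hasFDerivAt
  have h2 : HasFDerivAt (fun x => G (t, x)) ((fderiv ℝ G (t, x)).comp (.inr ℝ ℝ (ℝ × ℝ))) x :=
    hGd.comp x (hasFDerivAt_prodMk_right t x)
  have hP : HasFDerivAt (fun q : ℝ × (ℝ × ℝ) => ω q.1 q.2)
      (fderiv ℝ (fun q : ℝ × (ℝ × ℝ) => ω q.1 q.2) (t, x)) (t, x) :=
    (hs.differentiable one_ne_zero _).hasFDerivAt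
  have hFd : HasDerivAt F (deriv F (ω t x)) (ω t x) :=
    (hF.differentiable one_ne_zero _).hasDerivAt
  have hχd : HasFDerivAt (fun q : ℝ × (ℝ × ℝ) => χ q.2)
      ((fderiv ℝ χ x).comp (.snd ℝ ℝ (ℝ × ℝ))) (t, x) :=
    ((hχ.differentiable one_ne_zero x).hasFDerivAt).comp (t, x) hasFDerivAt_snd
  have h3 := (hFd.comp_hasFDerivAt (t, x) hP).mul hχd
  have h4 : fderiv ℝ G (t, x) (1, u t x) = F (ω t x) * fderiv ℝ χ x (u t x) := by
    rw [hGd.unique h3]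
    simp [h.fderiv_transport ht x]
  simp only [h2.fderiv, ContinuousLinearMap.comp_apply, ContinuousLinearMap.inr_apply, ← map_add]
  simpa using h4

end IsEulerSol
end

section
open Set Metric Topology

lemma exists_bound_Icc_of_local {E : ℝ → ℝ} {a b : ℝ}
    (h : ∀ t ∈ Icc a b, ∃ U ∈ 𝓝 t, ∃ M, ∀ s ∈ U, s ∈ Icc a b → E s ≤ M) :
    ∃ M, ∀ t ∈ Icc a b, E t ≤ M := by
  refine isCompact_Icc.induction_on (p := fun S => ∃ M, ∀ t ∈ S, E t ≤ M) ⟨0, by simp⟩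
    (fun S T hST ⟨M, hM⟩ => ⟨M, fun t ht => hM t (hST ht)⟩) ?_ ?_
  · rintro S T ⟨M, hM⟩ ⟨N, hN⟩
    exact ⟨max M N, fun t ht => ht.elim (fun h => (hM t h).trans (le_max_left _ _))
      fun h => (hN t h).trans (le_max_right _ _)⟩
  · intro t ht
    obtain ⟨U, hU, M, hM⟩ := h t ht
    exact ⟨U ∩ Icc a b, inter_mem (mem_nhdsWithin_of_mem_nhds hU) self_mem_nhdsWithin, M,
      fun s hs => hM s hs.1 hs.2⟩

/-- A lower semicontinuous quantity on `[0, ∞)` which is conserved as long as it stays bounded is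
conserved. The proof is a Baire category argument on the set of times of non-boundedness. -/
lemma conserved_of_conserved_of_bounded {E : ℝ → ℝ}
    (hclosed : ∀ M, IsClosed {t | 0 ≤ t ∧ E t ≤ M})
    (hcons : ∀ a b, 0 ≤ a → a ≤ b → (∃ M, ∀ t ∈ Icc a b, E t ≤ M) → E a = E b)
    (t : ℝ) : ∃ M, ∀ s ∈ Icc 0 t, E s ≤ M := by
  set G : Set ℝ := {t | ∃ U ∈ 𝓝 t, ∃ M, ∀ s ∈ U, 0 ≤ s → E s ≤ M} with hG
  have hGopen : IsOpen G := by
    rw [isOpen_iff_mem_nhds]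
    rintro t ⟨U, hU, M, hM⟩
    filter_upwards [eventually_mem_nhds_iff.2 hU] with s hs
    exact ⟨U, hs, M, hM⟩
  have hloc : ∀ a b, 0 ≤ a → (∀ t ∈ Icc a b, t ∈ G) → ∃ M, ∀ t ∈ Icc a b, E t ≤ M :=
    fun a b ha h => exists_bound_Icc_of_local fun t ht => by
      obtain ⟨U, hU, M, hM⟩ := h t ht
      exact ⟨U, hU, M, fun s hs hs' => hM s hs (ha.trans hs'.1)⟩
  suffices hall : ∀ t, 0 ≤ t → t ∈ G from hloc 0 t le_rfl fun s hs => hall s hs.1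
  by_contra! hne
  obtain ⟨t₁, ht₁, ht₁G⟩ := hne
  set B : Set ℝ := Ici 0 ∩ Gᶜ with hB
  have hBc : IsClosed B := isClosed_Ici.inter hGopen.isClosed_compl
  have : CompleteSpace B := hBc.completeSpace_coe
  have : Nonempty B := ⟨⟨t₁, ht₁, ht₁G⟩⟩
  obtain ⟨n, ⟨t₀, ht₀B⟩, ht₀⟩ := nonempty_interior_of_iUnion_of_closed
    (f := fun n : ℕ => ((↑) : B → ℝ) ⁻¹' {t | 0 ≤ t ∧ E t ≤ n})
    (fun n => (hclosed n).preimage continuous_subtype_val)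
    (by
      refine eq_univ_of_forall fun s => mem_iUnion.2 ?_
      obtain ⟨n, hn⟩ := exists_nat_ge (E s)
      exact ⟨n, s.2.1, hn⟩)
  rw [mem_interior_iff_mem_nhds, Metric.mem_nhds_iff] at ht₀
  obtain ⟨ε, hε, hball⟩ := ht₀
  have hEB : ∀ s ∈ B, |s - t₀| < ε → E s ≤ n := fun s hs hd =>
    (hball (show (⟨s, hs⟩ : B) ∈ ball _ ε from hd)).2
  refine ht₀B.2 ⟨ball t₀ ε, ball_mem_nhds _ hε, n, fun s hs hs0 => ?_⟩
  rw [mem_ball, Real.dist_eq] at hs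
  by_cases hsB : s ∈ B
  · exact hEB s hsB hs
  have hsG : s ∈ G := by
    by_contra hsG
    exact hsB ⟨hs0, hsG⟩
  rcases lt_or_gt_of_ne (fun h : s = t₀ => hsB (h ▸ ht₀B)) with hlt | hlt
  · have hc : IsCompact (B ∩ Icc s t₀) := isCompact_Icc.inter_left hBc
    have hmem := hc.sInf_mem ⟨t₀, ht₀B, hlt.le, le_rfl⟩
    set b := sInf (B ∩ Icc s t₀)
    have hEb : E b ≤ n := hEB b hmem.1 (by
      rw [abs_lt] at hs ⊢; constructor <;> linarith [hmem.2.1, hmem.2.2])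
    have hconst : ∀ c ∈ Ico s b, E s = E c := fun c hcI =>
      hcons s c hs0 hcI.1 (hloc s c hs0 fun r hr => by
        by_contra hrG
        have : b ≤ r := csInf_le hc.bddBelow
          ⟨⟨hs0.trans hr.1, hrG⟩, hr.1, by linarith [hr.2, hcI.2, hmem.2.2]⟩
        linarith [hr.2, hcI.2])
    rw [hcons s b hs0 hmem.2.1 ⟨max (E s) (E b), fun c hcI => ?_⟩]
    · exact hEb
    · rcases hcI.2.lt_or_eq with h | rfl
      · exact (hconst c ⟨hcI.1, h⟩).symm.le.trans (le_max_left _ _)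
      · exact le_max_right _ _
  · have hc : IsCompact (B ∩ Icc t₀ s) := isCompact_Icc.inter_left hBc
    have hmem := hc.sSup_mem ⟨t₀, ht₀B, le_rfl, hlt.le⟩
    set a := sSup (B ∩ Icc t₀ s)
    have ha0 : 0 ≤ a := hmem.1.1
    have hEa : E a ≤ n := hEB a hmem.1 (by
      rw [abs_lt] at hs ⊢; constructor <;> linarith [hmem.2.1, hmem.2.2])
    have hconst : ∀ c ∈ Ioc a s, E c = E s := fun c hcI =>
      hcons c s (ha0.trans hcI.1.le) hcI.2 (hloc c s (ha0.trans hcI.1.le) fun r hr => by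
        by_contra hrG
        have : r ≤ a := le_csSup hc.bddAbove
          ⟨⟨ha0.trans (hcI.1.le.trans hr.1), hrG⟩, by linarith [hr.1, hcI.1, hmem.2.1], hr.2⟩
        linarith [hr.1, hcI.1])
    rw [← hcons a s ha0 hmem.2.2 ⟨max (E s) (E a), fun c hcI => ?_⟩]
    · exact hEa
    · rcases hcI.1.lt_or_eq with h | rfl
      · exact (hconst c ⟨h, hcI.2⟩).le.trans (le_max_left _ _)
      · exact le_max_right _ _

/-- Smooth cutoffs at unit scale, adapted to dilations. -/
lemma exists_cutoff : ∃ χ : ℕ → ℝ × ℝ → ℝ, ∃ C : ℝ, 0 ≤ C ∧ ∀ n,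
    ContDiff ℝ 1 (χ n) ∧ HasCompactSupport (χ n) ∧ (∀ x, 0 ≤ χ n x) ∧ (∀ x, χ n x ≤ 1) ∧
    (∀ x, ‖x‖ ≤ n → χ n x = 1) ∧ ∀ x, ‖fderiv ℝ (χ n) x‖ ≤ C / (n + 1) := by
  let η : ContDiffBump (0 : ℝ × ℝ) := ⟨1, 2, by norm_num, by norm_num⟩
  have hη : ContDiff ℝ 1 η := η.contDiff
  obtain ⟨C, R, hC, -, hb, -⟩ := exists_fderiv_bound hη η.hasCompactSupport
  refine ⟨fun n x => η ((n + 1 : ℝ)⁻¹ • x), C, hC.le, fun n => ⟨?_, ?_, fun x => η.nonneg,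
    fun x => η.le_one, fun x hx => ?_, fun x => ?_⟩⟩
  · exact hη.comp (by fun_prop)
  · exact η.hasCompactSupport.comp_smul (by positivity)
  · refine η.one_of_mem_closedBall ?_
    rw [mem_closedBall_zero_iff, norm_smul, norm_inv, Real.norm_of_nonneg (by positivity)]
    change _ ≤ (1 : ℝ)
    rw [inv_mul_le_iff₀ (by positivity)]
    linarith
  · rw [fderiv_comp_smul, norm_smul, norm_inv, Real.norm_of_nonneg (by positivity),
      div_eq_inv_mul]
    gcongr
    exact hb _

lemma contDiff_abs_rpow {p : ℝ} (hp : 1 < p) : ContDiff ℝ 1 (fun s : ℝ => |s| ^ p) := by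
  simpa using contDiff_norm_rpow (E := ℝ) hp

namespace IsEulerSol

variable {ω : ℝ → ℝ × ℝ → ℝ} {u : ℝ → ℝ × ℝ → ℝ × ℝ}

lemma exists_integral_mul_cutoff (h : IsEulerSol ω u) {F : ℝ → ℝ} (hF0 : F 0 = 0)
    {χ : ℕ → ℝ × ℝ → ℝ} (hχ : ∀ n : ℕ, ∀ x, ‖x‖ ≤ n → χ n x = 1) (t : ℝ) :
    ∃ N : ℕ, ∀ n ≥ N, ∫ x, F (ω t x) * χ n x = ∫ x, F (ω t x) := by
  obtain ⟨R, hR0, hR⟩ := (h.compactSupp t).isCompact.isBounded.exists_pos_norm_lt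
  obtain ⟨N, hN⟩ := exists_nat_ge R
  refine ⟨N, fun n hn => integral_congr_ae (.of_forall fun x => ?_)⟩
  by_cases hx : ω t x = 0
  · simp [hx, hF0]
  · have h1 := (hR x (subset_tsupport _ hx)).le
    have h2 : (N : ℝ) ≤ n := by exact_mod_cast hn
    simp [hχ n x (by linarith)]

lemma integrable_comp (h : IsEulerSol ω u) {F : ℝ → ℝ} (hF : Continuous F) (hF0 : F 0 = 0)
    (t : ℝ) : Integrable (fun x => F (ω t x)) :=
  (hF.comp (h.continuous_slice t)).integrable_of_hasCompactSupport ((h.compactSupp t).comp_left hF0)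

lemma integral_comp_eq_of_bounded (h : IsEulerSol ω u) {p q : ℝ} (hpq : p.HolderConjugate q)
    (hq : q < 2) {F : ℝ → ℝ} (hF : ContDiff ℝ 1 F)
    (hFle : ∀ s, |F s| ≤ |s| ^ (3 / 2 : ℝ) + |s| ^ p) {a b M : ℝ} (ha : 0 ≤ a) (hab : a ≤ b)
    (hM : ∀ t ∈ Icc a b, ∫ y, (|ω t y| ^ (3 / 2 : ℝ) + |ω t y| ^ p) ≤ M) :
    ∫ x, F (ω a x) = ∫ x, F (ω b x) := by
  obtain ⟨χ, C, hC, hχ⟩ := exists_cutoff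
  have hF0 : F 0 = 0 := by
    have := hFle 0
    rw [abs_zero, Real.zero_rpow (by norm_num), Real.zero_rpow hpq.pos.ne', add_zero] at this
    exact abs_eq_zero.1 (le_antisymm this (abs_nonneg _))
  set κ := ∫ z, youngKernel q z
  have hκ : 0 ≤ κ := integral_nonneg (youngKernel_nonneg q)
  have hM0 : 0 ≤ M := (integral_nonneg fun y => by positivity).trans (hM a ⟨le_rfl, hab⟩)
  have hstep : ∀ n : ℕ, |(∫ x, F (ω b x) * χ n x) - ∫ x, F (ω a x) * χ n x| ≤
      C / (n + 1) * (2 * (M + κ)) * M * (b - a) := fun n => by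
    obtain ⟨hs, hcs, -, -, -, hd⟩ := hχ n
    have hder : ∀ t ∈ Icc a b, HasDerivWithinAt (fun s => ∫ x, F (ω s x) * χ n x)
        (∫ x, F (ω t x) * fderiv ℝ (χ n) x (u t x)) (Icc a b) t := fun t ht =>
      (h.hasDerivAt_truncated hF hs hcs (ha.trans ht.1)).hasDerivWithinAt
    have hbd : ∀ t ∈ Icc a b, ‖∫ x, F (ω t x) * fderiv ℝ (χ n) x (u t x)‖ ≤
        C / (n + 1) * (2 * (M + κ)) * M := fun t ht => by
      have hi := (integrable_abs_rpow (h.continuous_slice t) (h.compactSupp t)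
        (p := 3 / 2) (by norm_num)).add
        (integrable_abs_rpow (h.continuous_slice t) (h.compactSupp t) hpq.pos)
      refine (norm_integral_le_of_norm_le (hi.const_mul (C / (n + 1) * (2 * (M + κ))))
        (.of_forall fun x => ?_)).trans ?_
      · rw [norm_mul, mul_comm]
        have h1 := h.norm_vel_le hpq hq t x
        have h2 := hM t ht
        gcongr
        · refine (ContinuousLinearMap.le_opNorm _ _).trans ?_
          gcongr
          · exact hd x
          · exact h1.trans (by gcongr)
        · exact hFle _
      · rw [integral_const_mul]
        gcongr
        exact hM t ht
    have := (convex_Icc a b).norm_image_sub_le_of_norm_hasDerivWithin_le hder hbd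
      (left_mem_Icc.2 hab) (right_mem_Icc.2 hab)
    rwa [Real.norm_eq_abs, Real.norm_of_nonneg (sub_nonneg.2 hab)] at this
  obtain ⟨N₁, h₁⟩ := h.exists_integral_mul_cutoff hF0 (fun n => (hχ n).2.2.2.2.1) a
  obtain ⟨N₂, h₂⟩ := h.exists_integral_mul_cutoff hF0 (fun n => (hχ n).2.2.2.2.1) b
  have hlim : Tendsto (fun n : ℕ => C / ((n : ℝ) + 1) * (2 * (M + κ)) * M * (b - a)) atTop
      (𝓝 (0 * (2 * (M + κ)) * M * (b - a))) :=
    (((tendsto_const_div_atTop_nhds_zero_nat C).comp (tendsto_add_atTop_nat 1) |>.congr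
      fun n => by simp).mul_const _ |>.mul_const _ |>.mul_const _)
  have := ge_of_tendsto hlim (b := |(∫ x, F (ω b x)) - ∫ x, F (ω a x)|) (by
    filter_upwards [eventually_ge_atTop (max N₁ N₂)] with n hn
    rw [← h₁ n (le_trans (le_max_left _ _) hn), ← h₂ n (le_trans (le_max_right _ _) hn)]
    exact hstep n)
  simp only [zero_mul] at this
  linarith [abs_nonpos_iff.1 this]

/-- Conservation of all admissible integrals of the vorticity. -/
lemma integral_comp_eq (h : IsEulerSol ω u) {p q : ℝ} (hpq : p.HolderConjugate q)
    (hq : q < 2) {F : ℝ → ℝ} (hF : ContDiff ℝ 1 F)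
    (hFle : ∀ s, |F s| ≤ |s| ^ (3 / 2 : ℝ) + |s| ^ p) {t : ℝ} (ht : 0 ≤ t) :
    ∫ x, F (ω t x) = ∫ x, F (ω 0 x) := by
  set F₀ : ℝ → ℝ := fun s => |s| ^ (3 / 2 : ℝ) + |s| ^ p with hF₀
  have hF₀c : ContDiff ℝ 1 F₀ := (contDiff_abs_rpow (by norm_num)).add (contDiff_abs_rpow hpq.lt)
  have hF₀nn : ∀ s, 0 ≤ F₀ s := fun s => by positivity
  have hF₀le : ∀ s, |F₀ s| ≤ F₀ s := fun s => (abs_of_nonneg (hF₀nn s)).le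
  have hF₀0 : F₀ 0 = 0 := by simp [hF₀, hpq.pos.ne']
  obtain ⟨χ, C, hC, hχ⟩ := exists_cutoff
  have hclosed : ∀ M, IsClosed {t | 0 ≤ t ∧ ∫ x, F₀ (ω t x) ≤ M} := fun M => by
    have : {t | 0 ≤ t ∧ ∫ x, F₀ (ω t x) ≤ M} =
        ⋂ n : ℕ, Ici 0 ∩ (fun s => ∫ x, F₀ (ω s x) * χ n x) ⁻¹' Iic M := by
      ext s
      simp only [mem_ofPred_eq, mem_iInter, mem_inter_iff, mem_Ici, mem_preimage, mem_Iic]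
      refine ⟨fun ⟨h0, h1⟩ n => ⟨h0, le_trans ?_ h1⟩, fun hn => ⟨(hn 0).1, ?_⟩⟩
      · have hle : ∀ x, F₀ (ω s x) * χ n x ≤ F₀ (ω s x) := fun x =>
          mul_le_of_le_one_right (hF₀nn _) ((hχ n).2.2.2.1 x)
        exact integral_mono_of_nonneg (.of_forall fun x => mul_nonneg (hF₀nn _) ((hχ n).2.2.1 x))
          (h.integrable_comp hF₀c.continuous hF₀0 s) (.of_forall hle)
      · obtain ⟨N, hN⟩ := h.exists_integral_mul_cutoff hF₀0 (fun n => (hχ n).2.2.2.2.1) s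
        rw [← hN N le_rfl]
        exact (hn N).2
    rw [this]
    refine isClosed_iInter fun n => ContinuousOn.preimage_isClosed_of_isClosed (fun s hs => ?_)
      isClosed_Ici isClosed_Iic
    exact (h.hasDerivAt_truncated hF₀c (hχ n).1 (hχ n).2.1 hs).continuousAt.continuousWithinAt
  obtain ⟨M, hM⟩ := conserved_of_conserved_of_bounded (E := fun t => ∫ x, F₀ (ω t x)) hclosed
    (fun a b ha hab ⟨M, hM⟩ => h.integral_comp_eq_of_bounded hpq hq hF₀c hF₀le ha hab hM) t
  exact (h.integral_comp_eq_of_bounded hpq hq hF hFle le_rfl ht hM).symm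

lemma integral_abs_rpow_eq (h : IsEulerSol ω u) {p q : ℝ} (hpq : p.HolderConjugate q)
    (hq : q < 2) {t : ℝ} (ht : 0 ≤ t) : ∫ x, |ω t x| ^ p = ∫ x, |ω 0 x| ^ p :=
  h.integral_comp_eq hpq hq (contDiff_abs_rpow hpq.lt)
    (fun s => by rw [abs_of_nonneg (by positivity)]; linarith [show 0 ≤ |s| ^ (3 / 2 : ℝ) by positivity]) ht

lemma nonneg (h : IsEulerSol ω u) (h0 : ∀ x, 0 ≤ ω 0 x) {t : ℝ} (ht : 0 ≤ t) (x : ℝ × ℝ) :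
    0 ≤ ω t x := by
  have hpq : (3 : ℝ).HolderConjugate (3 / 2) := ⟨by norm_num, by norm_num, by norm_num⟩
  have hsplit : ∀ s : ℝ, |s| ^ (3 : ℝ) = |s| ^ (2 : ℝ) * |s| := fun s => by
    rw [show (3 : ℝ) = 2 + 1 by norm_num, Real.rpow_add_one' (abs_nonneg _) (by norm_num)]
  set F : ℝ → ℝ := fun s => |s| ^ (2 : ℝ) * s
  have hF : ContDiff ℝ 1 F := (contDiff_abs_rpow (by norm_num)).mul contDiff_id
  have h1 := h.integral_comp_eq hpq (by norm_num) hF (fun s => by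
    rw [abs_mul, abs_of_nonneg (a := |s| ^ (2 : ℝ)) (by positivity), ← hsplit]
    linarith [show 0 ≤ |s| ^ (3 / 2 : ℝ) by positivity]) ht
  have h2 := h.integral_abs_rpow_eq hpq (by norm_num) ht
  have h3 : ∫ x, |ω 0 x| ^ (3 : ℝ) = ∫ x, F (ω 0 x) := by
    refine integral_congr_ae (.of_forall fun x => ?_)
    simp only [hsplit, F]
    rw [abs_of_nonneg (h0 x)]
  have hi1 := integrable_abs_rpow (h.continuous_slice t) (h.compactSupp t) (p := 3) (by norm_num)
  have hi2 := h.integrable_comp hF.continuous (by simp [F]) t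
  have h4 : ∫ x, (|ω t x| ^ (3 : ℝ) - F (ω t x)) = 0 := by
    rw [integral_sub hi1 hi2, h1, h2, h3, sub_self]
  have hnn : ∀ x, 0 ≤ |ω t x| ^ (3 : ℝ) - F (ω t x) := fun x => by
    rw [hsplit, ← mul_sub]
    exact mul_nonneg (by positivity) (sub_nonneg.2 (le_abs_self _))
  have hcont : Continuous fun x => |ω t x| ^ (3 : ℝ) - F (ω t x) :=
    ((h.continuous_slice t).abs.rpow_const fun _ => Or.inr (by norm_num)).sub
      (hF.continuous.comp (h.continuous_slice t))
  have h5 := (integral_eq_zero_iff_of_nonneg hnn (hi1.sub hi2)).1 h4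
  have h6 := congrFun ((hcont.ae_eq_iff_eq _ continuous_const).1 h5) x
  simp only [hsplit, F, ← mul_sub] at h6
  rcases mul_eq_zero.1 h6 with h7 | h7
  · exact (abs_eq_zero.1 ((Real.rpow_eq_zero (abs_nonneg _) (by norm_num)).1 h7)).ge
  · rw [← sub_eq_zero.1 h7]; exact abs_nonneg _

end IsEulerSol
end

section
open Set Metric Topology

variable {f : ℝ × ℝ → ℝ}

lemma integrable_mul_norm_inv (hf : Continuous f) (hc : HasCompactSupport f) (x : ℝ × ℝ) :
    Integrable (fun y => f y * ‖x - y‖⁻¹) := by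
  have hpq : (3 : ℝ).HolderConjugate (3 / 2) := ⟨by norm_num, by norm_num, by norm_num⟩
  refine Integrable.mono' (((integrable_abs_rpow hf hc (p := 3 / 2) (by norm_num)).add
    (integrable_abs_rpow hf hc (p := 3) (by norm_num))).add
    ((integrable_youngKernel (q := 3 / 2) (by norm_num)).comp_sub_left x)) ?_
    (.of_forall fun y => ?_)
  · exact (hf.measurable.mul (by fun_prop)).aestronglyMeasurable
  · rw [norm_mul, norm_inv, norm_norm, Real.norm_eq_abs]
    exact abs_mul_norm_inv_le hpq _ _

lemma exists_young_scale {p q : ℝ} (hpq : p.HolderConjugate q) {N b : ℝ} (hN : 0 < N)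
    (hb : 0 < b) : ∃ l r : ℝ, 0 < l ∧ 0 < r ∧ r⁻¹ = N ^ (q / 2) * b ^ (-(q / 2)) ∧
      l ^ p * N ^ p = N ^ (q / 2) * b ^ (1 - q / 2) ∧
      l⁻¹ ^ q * r ^ (2 - q) = N ^ (q / 2) * b ^ (1 - q / 2) := by
  obtain ⟨n, rfl⟩ : ∃ n, N = Real.exp n := ⟨_, (Real.exp_log hN).symm⟩
  obtain ⟨β, rfl⟩ : ∃ β, b = Real.exp β := ⟨_, (Real.exp_log hb).symm⟩
  have hp := hpq.pos
  have hq := hpq.symm.pos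
  have hpq' : q / p = q - 1 := by
    have := hpq.mul_eq_add
    field_simp
    linarith
  refine ⟨Real.exp ((n * (q / 2) + β * (1 - q / 2)) / p - n), Real.exp ((β - n) * (q / 2)),
    Real.exp_pos _, Real.exp_pos _, ?_, ?_, ?_⟩
  · simp only [← Real.exp_mul, ← Real.exp_add, ← Real.exp_neg]
    congr 1; ring
  · simp only [← Real.exp_mul, ← Real.exp_add]
    congr 1; field_simp; ring
  · simp only [← Real.exp_mul, ← Real.exp_add, ← Real.exp_neg]
    congr 1
    have : -((n * (q / 2) + β * (1 - q / 2)) / p - n) * q =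
        -((n * (q / 2) + β * (1 - q / 2)) * (q / p)) + n * q := by ring
    rw [this, hpq']
    ring

/-- A linearised interpolation estimate for the Riesz-type potential `∫ f(y) / |x - y| dy`. -/
lemma integral_mul_norm_inv_le (hf : Continuous f) (hc : HasCompactSupport f) (hf0 : ∀ y, 0 ≤ f y)
    {p q : ℝ} (hpq : p.HolderConjugate q) (hq : q < 2) {N b : ℝ} (hN : 0 < N) (hb : 0 < b)
    (hfN : ∫ y, f y ^ p ≤ N ^ p) (x : ℝ × ℝ) :
    ∫ y, f y * ‖x - y‖⁻¹ ≤ N ^ (q / 2) * (b ^ (-(q / 2)) * (∫ y, f y) +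
      (1 + ∫ z in ball (0 : ℝ × ℝ) 1, ‖z‖ ^ (-q)) * b ^ (1 - q / 2)) := by
  obtain ⟨l, r, hl, hr, hr1, hl1, hlr⟩ := exists_young_scale hpq hN hb
  have hp := hpq.pos
  have hq0 := hpq.symm.pos
  set k : ℝ × ℝ → ℝ := (ball (0 : ℝ × ℝ) r).indicator fun z => ‖z‖ ^ (-q)
  have hk : Integrable k :=
    (integrable_indicator_iff measurableSet_ball).2 (integrableOn_ball_norm_rpow hq r)
  have hk0 : ∀ z, 0 ≤ k z := fun z => indicator_nonneg (fun _ _ => by positivity) z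
  have hfi : Integrable f := hf.integrable_of_hasCompactSupport hc
  have hfp : Integrable fun y => f y ^ p := by
    simpa only [abs_of_nonneg (hf0 _)] using integrable_abs_rpow hf hc hp
  have hpt : ∀ y, f y * ‖x - y‖⁻¹ ≤ (r⁻¹ * f y + l ^ p * f y ^ p) + l⁻¹ ^ q * k (x - y) := fun y => by
    have hfy := hf0 y
    by_cases hxy : ‖x - y‖ < r
    · have h1 := Real.young_inequality_of_nonneg (mul_nonneg hl.le hfy)
        (mul_nonneg (inv_nonneg.2 hl.le) (inv_nonneg.2 (norm_nonneg (x - y)))) hpq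
      have h2 : (l * f y) ^ p / p ≤ l ^ p * f y ^ p := by
        rw [Real.mul_rpow hl.le hfy]
        exact div_le_self (by positivity) hpq.lt.le
      have h3 : (l⁻¹ * ‖x - y‖⁻¹) ^ q / q ≤ l⁻¹ ^ q * k (x - y) := by
        rw [Real.mul_rpow (by positivity) (by positivity)]
        refine (div_le_self (by positivity) hpq.symm.lt.le).trans_eq ?_
        simp only [k]
        rw [indicator_of_mem (by simpa using hxy), Real.rpow_neg_eq_inv_rpow]
      have h4 : l * f y * (l⁻¹ * ‖x - y‖⁻¹) = f y * ‖x - y‖⁻¹ := by field_simp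
      have : 0 ≤ r⁻¹ * f y := by positivity
      linarith
    · push Not at hxy
      have h1 : f y * ‖x - y‖⁻¹ ≤ r⁻¹ * f y := by
        rw [mul_comm]; gcongr
      have : 0 ≤ l ^ p * f y ^ p := by positivity
      have : 0 ≤ l⁻¹ ^ q * k (x - y) := mul_nonneg (by positivity) (hk0 _)
      linarith
  have hi1 := (hfi.const_mul r⁻¹).add (hfp.const_mul (l ^ p))
  have hi2 := (hk.comp_sub_left x).const_mul (l⁻¹ ^ q)
  refine (integral_mono (integrable_mul_norm_inv hf hc x) (hi1.add hi2) hpt).trans ?_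
  rw [integral_add' hi1 hi2, integral_add' (hfi.const_mul r⁻¹) (hfp.const_mul (l ^ p)),
    integral_const_mul, integral_const_mul, integral_const_mul, integral_sub_left_eq_self,
    integral_indicator measurableSet_ball, integral_ball_norm_rpow q hr, hr1, ← mul_assoc, hlr]
  have : l ^ p * ∫ y, f y ^ p ≤ N ^ (q / 2) * b ^ (1 - q / 2) := by
    rw [← hl1]; gcongr
  linarith

lemma abs_vel_fst_le {ω : ℝ → ℝ × ℝ → ℝ} {u : ℝ → ℝ × ℝ → ℝ × ℝ} (h : IsEulerSol ω u) {t : ℝ}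
    (hn : ∀ x, 0 ≤ ω t x) {x : ℝ × ℝ} (hx : x ∈ Hplane) :
    |(u t x).1| ≤ 2 * ∫ y, ω t y * ‖x - y‖⁻¹ := by
  have hi := integrable_mul_norm_inv (h.continuous_slice t) (h.compactSupp t) x
  refine (norm_fst_le (u t x)).trans ?_
  rw [h.biotSavart]
  have hH : MeasurableSet Hplane := measurableSet_lt measurable_const measurable_snd
  refine (norm_integral_le_of_norm_le (hi.const_mul 2).integrableOn
    ((ae_restrict_iff' hH).2 ?_)).trans ?_
  · filter_upwards [compl_mem_ae_iff.2 (measure_singleton (μ := volume) x)] with y hy hyH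
    rw [norm_smul, Real.norm_of_nonneg (hn y), mul_left_comm]
    exact mul_le_mul_of_nonneg_left (norm_Kker_le hx hyH (fun h => hy h.symm)) (hn y)
  · rw [integral_const_mul, setIntegral_eq_integral_of_forall_compl_eq_zero]
    intro y hy
    rw [h.eq_zero_of_notMem t hy, zero_mul]

lemma integral_rescVort {ω : ℝ → ℝ × ℝ → ℝ} {u : ℝ → ℝ × ℝ → ℝ × ℝ} (h : IsEulerSol ω u) {t : ℝ}
    (ht : 0 < t) (g : ℝ × ℝ → ℝ) :
    ∫ y in Hplane, g y * rescVort ω t y = ∫ z, ω t z * g (t⁻¹ • z) := by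
  rw [setIntegral_eq_integral_of_forall_compl_eq_zero]
  · have h1 := Measure.integral_comp_smul_of_nonneg volume (fun z => ω t z * g (t⁻¹ • z)) t
      (hR := ht.le)
    simp only [smul_smul, inv_mul_cancel₀ ht.ne', one_smul, Module.finrank_prod,
      Module.finrank_self, smul_eq_mul] at h1
    have h2 : ∫ z, ω t z * g (t⁻¹ • z) = t ^ 2 * ∫ y, ω t (t • y) * g y := by
      rw [h1]; field_simp; ring
    rw [h2, ← integral_const_mul]
    refine integral_congr_ae (.of_forall fun y => ?_)
    simp only [rescVort]; ring
  · intro y hy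
    have : t • y ∉ Hplane := fun hy' => hy (by
      have : 0 < t * y.2 := hy'
      exact (mul_pos_iff_of_pos_left ht).1 this)
    simp [rescVort, h.eq_zero_of_notMem t this]

/-- Pointwise bound for the rescaled velocity, split into near and far interactions. -/
lemma abs_rescVel_fst_le {ω : ℝ → ℝ × ℝ → ℝ} {u : ℝ → ℝ × ℝ → ℝ × ℝ} (h : IsEulerSol ω u)
    (h0 : ∀ x, 0 ≤ ω 0 x) {t : ℝ} (ht : 0 < t) {p q : ℝ} (hpq : p.HolderConjugate q) (hq : q < 2)
    {N b δ : ℝ} (hN : 0 < N) (hb : 0 < b) (hδ : 0 < δ) (hN' : ∫ y, |ω 0 y| ^ p ≤ N ^ p)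
    {χ : ℝ → ℝ} (hχ : Continuous χ) (hχ0 : ∀ s, 0 ≤ χ s) (hχ1 : ∀ s, χ s ≤ 1)
    (hχδ : ∀ s, |s| ≤ δ → χ s = 1) {y : ℝ × ℝ} (hy : y ∈ Hplane) :
    |(rescVel u t y).1 / t| ≤ 2 * (t⁻¹ * (δ⁻¹ * ∫ z in Hplane, rescVort ω t z) +
      N ^ (q / 2) * (b ^ (-(q / 2)) * (∫ z in Hplane, χ (y.1 - z.1) * rescVort ω t z) +
      (1 + ∫ z in ball (0 : ℝ × ℝ) 1, ‖z‖ ^ (-q)) * b ^ (1 - q / 2))) := by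
  have hty : t • y ∈ Hplane := mul_pos ht hy
  have hn := fun x => h.nonneg h0 ht.le x
  have hfst : (rescVel u t y).1 / t = (u t (t • y)).1 := by
    simp only [rescVel, Prod.smul_fst, smul_eq_mul]; field_simp
  rw [hfst]
  refine (abs_vel_fst_le h hn hty).trans ?_
  have hχc : Continuous fun z : ℝ × ℝ => χ (y.1 - (t⁻¹ • z).1) := by fun_prop
  set f : ℝ × ℝ → ℝ := fun z => ω t z * χ (y.1 - (t⁻¹ • z).1) with hf
  have hfc : Continuous f := (h.continuous_slice t).mul hχc
  have hfs : HasCompactSupport f := (h.compactSupp t).mul_right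
  have hf0 : ∀ z, 0 ≤ f z := fun z => mul_nonneg (hn z) (hχ0 _)
  have hfle : ∀ z, f z ≤ ω t z := fun z => mul_le_of_le_one_right (hn z) (hχ1 _)
  have hfN : ∫ z, f z ^ p ≤ N ^ p := by
    refine le_trans ?_ hN'
    rw [← h.integral_abs_rpow_eq hpq hq ht.le]
    refine integral_mono_of_nonneg (.of_forall fun z => Real.rpow_nonneg (hf0 z) _)
      (integrable_abs_rpow (h.continuous_slice t) (h.compactSupp t) hpq.pos)
      (.of_forall fun z => ?_)
    exact Real.rpow_le_rpow (hf0 z) ((hfle z).trans (le_abs_self _)) hpq.nonneg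
  have hM : ∫ z in Hplane, rescVort ω t z = ∫ z, ω t z := by
    simpa using integral_rescVort h ht (fun _ => 1)
  have hm : ∫ z in Hplane, χ (y.1 - z.1) * rescVort ω t z = ∫ z, f z :=
    integral_rescVort h ht (fun z => χ (y.1 - z.1))
  have hmain := integral_mul_norm_inv_le hfc hfs hf0 hpq hq hN hb hfN (t • y)
  have hωi := (h.continuous_slice t).integrable_of_hasCompactSupport (h.compactSupp t) (μ := volume)
  have hpt : ∀ z, ω t z * ‖t • y - z‖⁻¹ ≤ t⁻¹ * δ⁻¹ * ω t z + f z * ‖t • y - z‖⁻¹ := fun z => by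
    have hωz := hn z
    by_cases hz : |y.1 - (t⁻¹ • z).1| ≤ δ
    · have : f z = ω t z := by simp only [hf]; rw [hχδ _ hz, mul_one]
      rw [this]
      have : 0 ≤ t⁻¹ * δ⁻¹ * ω t z := by positivity
      linarith
    · push Not at hz
      have h1 : t * δ ≤ ‖t • y - z‖ := by
        refine le_trans ?_ (norm_fst_le _)
        have : (t • y - z).1 = t * (y.1 - (t⁻¹ • z).1) := by
          simp only [Prod.fst_sub, Prod.smul_fst, smul_eq_mul]; field_simp
        rw [this, norm_mul, Real.norm_of_nonneg ht.le]
        exact mul_le_mul_of_nonneg_left hz.le ht.le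
      have h2 : ω t z * ‖t • y - z‖⁻¹ ≤ t⁻¹ * δ⁻¹ * ω t z := by
        rw [mul_comm, ← mul_inv]; gcongr
      have : 0 ≤ f z * ‖t • y - z‖⁻¹ := mul_nonneg (hf0 z) (by positivity)
      linarith
  refine mul_le_mul_of_nonneg_left ?_ zero_le_two
  have hi1 := hωi.const_mul (t⁻¹ * δ⁻¹)
  have hi2 := integrable_mul_norm_inv hfc hfs (t • y)
  refine (integral_mono (integrable_mul_norm_inv (h.continuous_slice t) (h.compactSupp t) (t • y))
    (hi1.add hi2) hpt).trans ?_
  rw [integral_add' hi1 hi2, integral_const_mul, hM, hm, mul_assoc]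
  gcongr

end

section

open Set Metric Topology

lemma tendsto_integral_prod_self {τ : ℕ → Measure ℝ} [∀ k, IsFiniteMeasure (τ k)] {μ : Measure ℝ}
    [IsFiniteMeasure μ]
    (h : ∀ f : ℝ → ℝ, Continuous f → (∃ B, ∀ s, |f s| ≤ B) →
      Tendsto (fun k => ∫ s, f s ∂τ k) atTop (𝓝 (∫ s, f s ∂μ)))
    {G : ℝ × ℝ → ℝ} (hG : Continuous G) {B : ℝ} (hB : ∀ z, |G z| ≤ B) :
    Tendsto (fun k => ∫ z, G z ∂((τ k).prod (τ k))) atTop (𝓝 (∫ z, G z ∂(μ.prod μ))) := by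
  let T : ℕ → FiniteMeasure ℝ := fun k => ⟨τ k, inferInstance⟩
  let M : FiniteMeasure ℝ := ⟨μ, inferInstance⟩
  have hT : Tendsto T atTop (𝓝 M) := by
    rw [FiniteMeasure.tendsto_iff_forall_integral_tendsto]
    exact fun f => h f f.continuous ⟨‖f‖, fun s => f.norm_coe_le_norm s⟩
  have hmass : Tendsto (fun k => ((T k).mass : ℝ)) atTop (𝓝 (M.mass : ℝ)) :=
    (NNReal.continuous_coe.tendsto _).comp hT.mass
  have key : ∀ F : FiniteMeasure ℝ, ∫ z, G z ∂((F : Measure ℝ).prod (F : Measure ℝ)) =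
      (F.mass : ℝ) * F.mass * ∫ z, G z ∂((F.normalize : Measure ℝ).prod (F.normalize : Measure ℝ)) := by
    intro F
    have e : (F : Measure ℝ) = F.mass • (F.normalize : Measure ℝ) := by
      have := congrArg (fun F : FiniteMeasure ℝ => (F : Measure ℝ)) F.self_eq_mass_smul_normalize
      simpa using this
    conv_lhs => rw [e]
    rw [Measure.prod_smul_left, Measure.prod_smul_right, integral_smul_nnreal_measure,
      integral_smul_nnreal_measure, NNReal.smul_def, NNReal.smul_def, smul_eq_mul, smul_eq_mul]
    ring
  change Tendsto (fun k => ∫ z, G z ∂((T k : Measure ℝ).prod (T k : Measure ℝ))) atTop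
    (𝓝 (∫ z, G z ∂((M : Measure ℝ).prod (M : Measure ℝ))))
  simp only [key]
  by_cases hM : M = 0
  · have h0 : (M.mass : ℝ) = 0 := by simp [hM]
    rw [h0] at hmass ⊢
    have hb : ∀ F : FiniteMeasure ℝ,
        ‖∫ z, G z ∂((F.normalize : Measure ℝ).prod (F.normalize : Measure ℝ))‖ ≤ B := by
      intro F
      have := norm_integral_le_of_norm_le_const
        (μ := (F.normalize : Measure ℝ).prod (F.normalize : Measure ℝ)) (f := G) (C := B)
        (Eventually.of_forall hB)
      simpa using this
    have h2 : Tendsto (fun k => ((T k).mass : ℝ) * (T k).mass) atTop (𝓝 0) := by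
      simpa using hmass.mul hmass
    simpa using h2.zero_mul_isBoundedUnder_le
      (isBoundedUnder_of ⟨B, fun k => by simpa using hb (T k)⟩)
  · have hn := FiniteMeasure.tendsto_normalize_of_tendsto hT hM
    have hp := (ProbabilityMeasure.continuous_prod (α := ℝ) (β := ℝ)).continuousAt.tendsto.comp
      (hn.prodMk_nhds hn)
    have hi := (ProbabilityMeasure.tendsto_iff_forall_integral_tendsto.1 hp)
      (BoundedContinuousFunction.ofNormedAddCommGroup G hG B hB)
    exact (hmass.mul hmass).mul hi

lemma exists_horizontal_marginal {W : ℝ × ℝ → ℝ} (hW : Integrable W (volume.restrict Hplane))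
    (h0 : ∀ y, 0 ≤ W y) (hm : Measurable W) :
    ∃ τ : Measure ℝ, IsFiniteMeasure τ ∧
      ∀ f : ℝ → ℝ, Measurable f → ∫ s, f s ∂τ = ∫ y in Hplane, f y.1 * W y := by
  let σ := (volume.restrict Hplane).withDensity fun y => ENNReal.ofReal (W y)
  have : IsFiniteMeasure σ := isFiniteMeasure_withDensity_ofReal hW.2
  refine ⟨σ.map Prod.fst, inferInstance, fun f hf => ?_⟩
  rw [integral_map measurable_fst.aemeasurable hf.aestronglyMeasurable]
  have := integral_withDensity_eq_integral_toReal_smul (μ := volume.restrict Hplane)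
    (f := fun y => ENNReal.ofReal (W y)) hm.ennreal_ofReal (by simp) (fun y : ℝ × ℝ => f y.1)
  rw [this]
  refine integral_congr_ae (Eventually.of_forall fun y => ?_)
  simp [ENNReal.toReal_ofReal (h0 y), mul_comm]

end

section

open Set Metric Topology

lemma exists_tendsto_averaged_bound {τ : ℕ → Measure ℝ} [∀ k, IsFiniteMeasure (τ k)]
    {μ : Measure ℝ} [IsFiniteMeasure μ]
    (h : ∀ f : ℝ → ℝ, Continuous f → (∃ B, ∀ s, |f s| ≤ B) →
      Tendsto (fun k => ∫ s, f s ∂τ k) atTop (𝓝 (∫ s, f s ∂μ)))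
    {ψ χ b : ℝ → ℝ} (hψ : Continuous ψ) {B : ℝ} (hB : ∀ s, |ψ s| ≤ B)
    (hχ : Continuous χ) (hχ0 : ∀ s, 0 ≤ χ s) (hχ1 : ∀ s, χ s ≤ 1)
    (hb : Continuous b) {ε R : ℝ} (hε : 0 < ε) (hbε : ∀ s, ε ≤ b s) (hbR : ∀ s, b s ≤ R)
    (hbχ : ∀ s, ∫ s', χ (s - s') ∂μ ≤ b s)
    {a : ℕ → ℝ} (ha : Tendsto a atTop (𝓝 0)) {K C r : ℝ} (hK : 0 ≤ K) (hr : 0 < r) (hr1 : r < 1) :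
    ∃ L ≤ 2 * K * (1 + C) * ∫ s, |ψ s| * b s ^ (1 - r) ∂μ,
      Tendsto (fun k => ∫ s, |ψ s| * (2 * (a k * (∫ _, 1 ∂τ k) + K * (b s ^ (-r) *
        (∫ s', χ (s - s') ∂τ k) + C * b s ^ (1 - r)))) ∂τ k) atTop (𝓝 L) := by
  have hb0 : ∀ s, 0 < b s := fun s => hε.trans_le (hbε s)
  have hB0 : 0 ≤ B := (abs_nonneg _).trans (hB 0)
  have hcr : Continuous fun s => b s ^ (-r) := hb.rpow_const fun s => Or.inl (hb0 s).ne'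
  have hc1 : Continuous fun s => b s ^ (1 - r) := hb.rpow_const fun s => Or.inl (hb0 s).ne'
  have hrb : ∀ s, b s ^ (-r) ≤ ε ^ (-r) := fun s =>
    Real.rpow_le_rpow_of_nonpos hε (hbε s) (by linarith)
  have h1b : ∀ s, b s ^ (1 - r) ≤ R ^ (1 - r) := fun s =>
    Real.rpow_le_rpow (hb0 s).le (hbR s) (by linarith)
  let G : ℝ × ℝ → ℝ := fun z => |ψ z.1| * b z.1 ^ (-r) * χ (z.1 - z.2)
  have hG : Continuous G := by
    exact ((hψ.abs.comp continuous_fst).mul (hcr.comp continuous_fst)).mul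
      (hχ.comp (continuous_fst.sub continuous_snd))
  have hGB : ∀ z, |G z| ≤ B * ε ^ (-r) := by
    intro z
    have e1 : 0 ≤ b z.1 ^ (-r) := Real.rpow_nonneg (hb0 _).le _
    have : 0 ≤ G z := by
      have := hχ0 (z.1 - z.2); simp only [G]; positivity
    rw [abs_of_nonneg this]
    calc G z ≤ (B * ε ^ (-r)) * 1 :=
          mul_le_mul (mul_le_mul (hB _) (hrb _) e1 hB0) (hχ1 _) (hχ0 _) (by positivity)
      _ = _ := mul_one _
  let P : ℝ → ℝ := fun s => |ψ s| * b s ^ (1 - r)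
  have hP : Continuous P := hψ.abs.mul hc1
  have hPB : ∀ s, |P s| ≤ B * R ^ (1 - r) := by
    intro s
    have e1 : 0 ≤ b s ^ (1 - r) := Real.rpow_nonneg (hb0 _).le _
    rw [abs_of_nonneg (by simp only [P]; positivity)]
    exact mul_le_mul (hB _) (h1b _) e1 hB0
  have hint : ∀ (σ : Measure ℝ) [IsFiniteMeasure σ] (f : ℝ → ℝ), Continuous f → ∀ D,
      (∀ s, |f s| ≤ D) → Integrable f σ := fun σ _ f hf D hD =>
    Integrable.of_bound hf.aestronglyMeasurable D (Eventually.of_forall hD)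
  have hGint : ∀ (σ : Measure ℝ) [IsFiniteMeasure σ], Integrable G (σ.prod σ) := fun σ _ =>
    Integrable.of_bound hG.aestronglyMeasurable _ (Eventually.of_forall hGB)
  have hGi : ∀ (σ : Measure ℝ) [IsFiniteMeasure σ],
      ∫ z, G z ∂(σ.prod σ) = ∫ s, |ψ s| * (b s ^ (-r) * ∫ s', χ (s - s') ∂σ) ∂σ := by
    intro σ _
    rw [integral_prod _ (hGint σ)]
    refine integral_congr_ae (Eventually.of_forall fun s => ?_)
    simp only [G]
    rw [integral_const_mul, mul_assoc]
  have hGi' : ∀ (σ : Measure ℝ) [IsFiniteMeasure σ],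
      Integrable (fun s => |ψ s| * (b s ^ (-r) * ∫ s', χ (s - s') ∂σ)) σ := by
    intro σ _
    refine (hGint σ).integral_prod_left.congr (Eventually.of_forall fun s => ?_)
    simp only [G]
    rw [integral_const_mul, mul_assoc]
  have hψi : ∀ (σ : Measure ℝ) [IsFiniteMeasure σ], Integrable (fun s => |ψ s|) σ :=
    fun σ _ => hint σ _ hψ.abs B (fun s => by simpa using hB s)
  have hPi : ∀ (σ : Measure ℝ) [IsFiniteMeasure σ], Integrable P σ :=
    fun σ _ => hint σ _ hP _ hPB
  refine ⟨2 * K * (∫ z, G z ∂(μ.prod μ)) + 2 * K * C * ∫ s, P s ∂μ, ?_, ?_⟩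
  · have : ∫ z, G z ∂(μ.prod μ) ≤ ∫ s, P s ∂μ := by
      rw [hGi μ]
      refine integral_mono (hGi' μ) (hPi μ) fun s => ?_
      refine mul_le_mul_of_nonneg_left ?_ (abs_nonneg _)
      calc b s ^ (-r) * ∫ s', χ (s - s') ∂μ ≤ b s ^ (-r) * b s :=
            mul_le_mul_of_nonneg_left (hbχ s) (Real.rpow_nonneg (hb0 _).le _)
        _ = b s ^ (1 - r) := by
            conv_lhs => rw [← Real.rpow_one (b s), ← Real.rpow_mul (hb0 s).le, one_mul]
            rw [← Real.rpow_add (hb0 s)]; congr 1; ring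
    have := mul_le_mul_of_nonneg_left this (show 0 ≤ 2 * K by linarith)
    change _ ≤ 2 * K * (1 + C) * ∫ s, P s ∂μ
    linarith
  · have hk : ∀ k, ∫ s, |ψ s| * (2 * (a k * (∫ _, 1 ∂τ k) + K * (b s ^ (-r) *
        (∫ s', χ (s - s') ∂τ k) + C * b s ^ (1 - r)))) ∂τ k =
        a k * (2 * (∫ _, 1 ∂τ k) * ∫ s, |ψ s| ∂τ k) +
          (2 * K * (∫ z, G z ∂((τ k).prod (τ k))) + 2 * K * C * ∫ s, P s ∂τ k) := by
      intro k
      generalize ∫ _, (1 : ℝ) ∂τ k = M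
      have hadd : Integrable (fun s => 2 * K * (|ψ s| * (b s ^ (-r) * ∫ s', χ (s - s') ∂τ k)) +
          2 * K * C * P s) (τ k) := ((hGi' _).const_mul _).add ((hPi _).const_mul _)
      rw [hGi (τ k), ← integral_const_mul (2 * K), ← integral_const_mul (2 * K * C),
        ← integral_const_mul (2 * M), ← integral_const_mul (a k),
        ← integral_add ((hGi' _).const_mul _) ((hPi _).const_mul _),
        ← integral_add (((hψi _).const_mul _).const_mul _) hadd]
      refine integral_congr_ae (Eventually.of_forall fun s => ?_)
      simp only [P]
      ring
    simp only [hk]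
    have t1 := h (fun _ => 1) continuous_const ⟨1, fun _ => by simp⟩
    have t2 := h _ hψ.abs ⟨B, fun s => by simpa using hB s⟩
    have t3 := tendsto_integral_prod_self h hG hGB
    have t4 := h P hP ⟨_, hPB⟩
    simpa using (ha.mul ((t1.const_mul 2).mul t2)).add ((t3.const_mul (2 * K)).add
      (t4.const_mul (2 * K * C)))

lemma integral_mul_rpow_measureReal_singleton {μ ν : Measure ℝ} [IsFiniteMeasure μ] {A : Set ℝ}
    {m : ℝ → ℝ} (hA : A.Countable) (hν : ∀ x, ν {x} = 0) (hm : ∀ α ∈ A, 0 < m α)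
    (hμ : μ = ν + Measure.sum fun α : A => ENNReal.ofReal (m α) • Measure.dirac (α : ℝ))
    {ψ : ℝ → ℝ} {θ : ℝ} (hθ : 0 < θ)
    (hi : Integrable (fun s => |ψ s| * μ.real {s} ^ θ) μ) :
    ∫ s, |ψ s| * μ.real {s} ^ θ ∂μ = ∑' α : A, m α ^ (1 + θ) * |ψ α| := by
  have hsing : ∀ s, μ {s} = ∑' α : A, ENNReal.ofReal (m α) * indicator {s} 1 (α : ℝ) := by
    intro s
    rw [hμ, Measure.add_apply, hν, zero_add, Measure.sum_apply _ (measurableSet_singleton s)]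
    simp [Measure.dirac_apply' _ (measurableSet_singleton s)]
  have hoff : ∀ s, s ∉ A → μ.real {s} = 0 := by
    intro s hs
    have : μ {s} = 0 := by
      rw [hsing, ENNReal.tsum_eq_zero]
      rintro ⟨α, hα⟩
      have : α ≠ s := fun e => hs (e ▸ hα)
      simp [this]
    simp [Measure.real, this]
  have hon : ∀ s ∈ A, μ.real {s} = m s := by
    intro s hs
    have : μ {s} = ENNReal.ofReal (m s) := by
      rw [hsing, tsum_eq_single (⟨s, hs⟩ : A)]
      · simp
      · rintro ⟨α, hα⟩ hne
        have : α ≠ s := fun e => hne (Subtype.ext e)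
        simp [this]
    simp [Measure.real, this, (hm s hs).le]
  rw [← setIntegral_eq_integral_of_forall_compl_eq_zero (s := A) (fun s hs => by
    rw [hoff s hs, Real.zero_rpow hθ.ne', mul_zero]), setIntegral_countable _ hA hi.integrableOn]
  refine tsum_congr fun α => ?_
  rw [hon α α.2, Real.rpow_add (hm α α.2), Real.rpow_one, smul_eq_mul]
  ring

lemma continuous_integral_comp_sub {χ : ℝ → ℝ} (hχ : Continuous χ) (hχ0 : ∀ s, 0 ≤ χ s)
    (hχ1 : ∀ s, χ s ≤ 1) (τ : Measure ℝ) [IsFiniteMeasure τ] :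
    Continuous fun s => ∫ s', χ (s - s') ∂τ := by
  refine continuous_of_dominated (F := fun s s' => χ (s - s')) (bound := fun _ => 1)
    (fun s => (hχ.comp (continuous_const.sub continuous_id)).aestronglyMeasurable)
    (fun s => Eventually.of_forall fun s' => ?_) (integrable_const _)
    (Eventually.of_forall fun s' => hχ.comp (continuous_id.sub continuous_const))
  rw [Real.norm_eq_abs, abs_of_nonneg (hχ0 _)]; exact hχ1 _

lemma exists_bump_sequence (μ : Measure ℝ) [IsFiniteMeasure μ] :
    ∃ (χ b : ℕ → ℝ → ℝ), (∀ n, Continuous (χ n)) ∧ (∀ n s, 0 ≤ χ n s) ∧ (∀ n s, χ n s ≤ 1) ∧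
      (∀ (n : ℕ) s, |s| ≤ 1 / ((n : ℝ) + 1) → χ n s = 1) ∧ (∀ n, Continuous (b n)) ∧
      (∀ (n : ℕ) s, 1 / ((n : ℝ) + 1) ≤ b n s) ∧ (∀ n s, b n s ≤ μ.real univ + 1) ∧
      (∀ n s, ∫ s', χ n (s - s') ∂μ ≤ b n s) ∧
      ∀ s, Tendsto (fun n => b n s) atTop (𝓝 (μ.real {s})) := by
  let χ : ℕ → ℝ → ℝ := fun n s => min 1 (max 0 (2 - ((n : ℝ) + 1) * |s|))
  have hχ : ∀ n, Continuous (χ n) := fun n => by fun_prop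
  have hχ0 : ∀ n s, 0 ≤ χ n s := fun n s => le_min zero_le_one (le_max_left _ _)
  have hχ1 : ∀ n s, χ n s ≤ 1 := fun n s => min_le_left _ _
  have hn1 : ∀ n : ℕ, (1 : ℝ) / (n + 1) ≤ 1 := fun n => by
    rw [div_le_one (by positivity)]; linarith [Nat.cast_nonneg (α := ℝ) n]
  have hint : ∀ n s, Integrable (fun s' => χ n (s - s')) μ := fun n s =>
    Integrable.of_bound ((hχ n).comp (continuous_const.sub continuous_id)).aestronglyMeasurable 1
      (Eventually.of_forall fun s' => by
        rw [Real.norm_eq_abs, abs_of_nonneg (hχ0 _ _)]; exact hχ1 _ _)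
  refine ⟨χ, fun n s => (∫ s', χ n (s - s') ∂μ) + 1 / ((n : ℝ) + 1), hχ, hχ0, hχ1, ?_, ?_, ?_, ?_,
    ?_, ?_⟩
  · intro n s hs
    rw [le_div_iff₀ (by positivity)] at hs
    exact min_eq_left (le_max_of_le_right (by linarith))
  · intro n
    exact (continuous_integral_comp_sub (hχ n) (hχ0 n) (hχ1 n) μ).add continuous_const
  · intro n s
    have : 0 ≤ ∫ s', χ n (s - s') ∂μ := integral_nonneg fun s' => hχ0 n (s - s')
    linarith
  · intro n s
    have : ∫ s', χ n (s - s') ∂μ ≤ ∫ _, (1 : ℝ) ∂μ :=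
      integral_mono (hint n s) (integrable_const _) fun s' => hχ1 _ _
    simp only [integral_const, smul_eq_mul, mul_one] at this
    linarith [hn1 n]
  · intro n s
    have : (0 : ℝ) ≤ 1 / ((n : ℝ) + 1) := by positivity
    linarith
  · intro s
    have e : μ.real {s} = ∫ s', indicator {s} (fun _ => (1 : ℝ)) s' ∂μ := by
      rw [integral_indicator (measurableSet_singleton s)]; simp [Measure.real]
    rw [e, ← add_zero (∫ s', _ ∂μ)]
    refine Tendsto.add ?_ tendsto_one_div_add_atTop_nhds_zero_nat
    refine tendsto_integral_of_dominated_convergence (fun _ => 1) (fun n => (hint n s).1)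
      (integrable_const _) (fun n => Eventually.of_forall fun s' => ?_)
      (Eventually.of_forall fun s' => ?_)
    · rw [Real.norm_eq_abs, abs_of_nonneg (hχ0 _ _)]; exact hχ1 _ _
    · by_cases hs : s' = s
      · subst hs
        simp [χ]
      · have hpos : 0 < |s - s'| := abs_pos.2 (sub_ne_zero.2 (Ne.symm hs))
        simp only [indicator, mem_singleton_iff, hs, if_false]
        refine tendsto_const_nhds.congr' ?_
        obtain ⟨n0, hn0⟩ := exists_nat_gt (2 / |s - s'|)
        filter_upwards [eventually_ge_atTop n0] with n hn
        have h1 : 2 / |s - s'| < (n : ℝ) + 1 := by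
          have : (n0 : ℝ) ≤ n := by exact_mod_cast hn
          linarith
        rw [div_lt_iff₀ hpos] at h1
        simp only [χ]
        rw [max_eq_left (by linarith), min_eq_right zero_le_one]

lemma tendsto_integral_mul_rpow {μ : Measure ℝ} [IsFiniteMeasure μ] {ψ : ℝ → ℝ}
    (hψ : Continuous ψ) {B : ℝ} (hB : ∀ s, |ψ s| ≤ B) {θ R : ℝ} (hθ : 0 < θ) {b : ℕ → ℝ → ℝ}
    {c : ℝ → ℝ} (hb : ∀ n, Continuous (b n)) (hb0 : ∀ n s, 0 ≤ b n s) (hbR : ∀ n s, b n s ≤ R)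
    (hbc : ∀ s, Tendsto (fun n => b n s) atTop (𝓝 (c s))) :
    Integrable (fun s => |ψ s| * c s ^ θ) μ ∧
      Tendsto (fun n => ∫ s, |ψ s| * b n s ^ θ ∂μ) atTop (𝓝 (∫ s, |ψ s| * c s ^ θ ∂μ)) := by
  have hB0 : 0 ≤ B := (abs_nonneg _).trans (hB 0)
  have hm : ∀ n, Continuous fun s => |ψ s| * b n s ^ θ := fun n =>
    hψ.abs.mul ((hb n).rpow_const fun _ => Or.inr hθ.le)
  have hlim : ∀ s, Tendsto (fun n => |ψ s| * b n s ^ θ) atTop (𝓝 (|ψ s| * c s ^ θ)) := fun s =>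
    ((hbc s).rpow_const (Or.inr hθ.le)).const_mul _
  have hbd : ∀ n s, ‖|ψ s| * b n s ^ θ‖ ≤ B * R ^ θ := by
    intro n s
    have := Real.rpow_nonneg (hb0 n s) θ
    rw [Real.norm_eq_abs, abs_of_nonneg (by positivity)]
    exact mul_le_mul (hB s) (Real.rpow_le_rpow (hb0 n s) (hbR n s) hθ.le) this hB0
  refine ⟨Integrable.of_bound (aestronglyMeasurable_of_tendsto_ae atTop
    (fun n => (hm n).aestronglyMeasurable) (Eventually.of_forall hlim)) (B * R ^ θ)
    (Eventually.of_forall fun s => le_of_tendsto (hlim s).norm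
      (Eventually.of_forall fun n => hbd n s)), ?_⟩
  exact tendsto_integral_of_dominated_convergence (fun _ => B * R ^ θ)
    (fun n => (hm n).aestronglyMeasurable) (integrable_const _)
    (fun n => Eventually.of_forall fun s => hbd n s) (Eventually.of_forall hlim)

end

section

open Set Metric Topology

namespace IsEulerSol

variable {ω : ℝ → ℝ × ℝ → ℝ} {u : ℝ → ℝ × ℝ → ℝ × ℝ}

lemma continuous_rescVort (h : IsEulerSol ω u) (t : ℝ) : Continuous (rescVort ω t) :=
  continuous_const.mul ((h.continuous_slice t).comp (continuous_const_smul t))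

lemma hasCompactSupport_rescVort (h : IsEulerSol ω u) {t : ℝ} (ht : 0 < t) :
    HasCompactSupport (rescVort ω t) :=
  ((h.compactSupp t).comp_smul ht.ne').mul_left

lemma rescVort_nonneg (h : IsEulerSol ω u) (h0 : ∀ x, 0 ≤ ω 0 x) {t : ℝ} (ht : 0 < t)
    (y : ℝ × ℝ) : 0 ≤ rescVort ω t y :=
  mul_nonneg (sq_nonneg t) (h.nonneg h0 ht.le _)

/-- The momentum flux against `ψ` is bounded by an average over the horizontal marginal of the
rescaled vorticity. -/
lemma abs_integral_mul_rescVel_le (h : IsEulerSol ω u)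
    (h0 : ∀ x, 0 ≤ ω 0 x) {t : ℝ} (ht : 0 < t) {p q : ℝ} (hpq : p.HolderConjugate q) (hq : q < 2)
    {N δ : ℝ} (hN : 0 < N) (hδ : 0 < δ) (hN' : ∫ y, |ω 0 y| ^ p ≤ N ^ p)
    {ψ χ b : ℝ → ℝ} (hψ : Continuous ψ)
    (hχ : Continuous χ) (hχ0 : ∀ s, 0 ≤ χ s) (hχ1 : ∀ s, χ s ≤ 1)
    (hχδ : ∀ s, |s| ≤ δ → χ s = 1) (hb : Continuous b) (hb0 : ∀ s, 0 < b s)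
    {τ : Measure ℝ} [IsFiniteMeasure τ]
    (hτ : ∀ f : ℝ → ℝ, Measurable f → ∫ s, f s ∂τ = ∫ y in Hplane, f y.1 * rescVort ω t y) :
    |∫ y in Hplane, ψ y.1 * ((rescVel u t y).1 / t) * rescVort ω t y| ≤
      ∫ s, |ψ s| * (2 * (t⁻¹ * δ⁻¹ * (∫ _, 1 ∂τ) + N ^ (q / 2) * (b s ^ (-(q / 2)) *
        (∫ s', χ (s - s') ∂τ) +
        (1 + ∫ z in ball (0 : ℝ × ℝ) 1, ‖z‖ ^ (-q)) * b s ^ (1 - q / 2)))) ∂τ := by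
  have hH : MeasurableSet Hplane := measurableSet_lt measurable_const measurable_snd
  set g : ℝ → ℝ := fun s => |ψ s| * (2 * (t⁻¹ * δ⁻¹ * (∫ _, 1 ∂τ) + N ^ (q / 2) *
    (b s ^ (-(q / 2)) * (∫ s', χ (s - s') ∂τ) +
      (1 + ∫ z in ball (0 : ℝ × ℝ) 1, ‖z‖ ^ (-q)) * b s ^ (1 - q / 2)))) with hg
  have hgc : Continuous g := by
    have c1 : Continuous fun s => b s ^ (-(q / 2)) :=
      hb.rpow_const fun s => Or.inl (hb0 s).ne'
    have c2 : Continuous fun s => b s ^ (1 - q / 2) :=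
      hb.rpow_const fun s => Or.inl (hb0 s).ne'
    have c3 := continuous_integral_comp_sub hχ hχ0 hχ1 τ
    exact hψ.abs.mul (continuous_const.mul (continuous_const.add (continuous_const.mul
      ((c1.mul c3).add (continuous_const.mul c2)))))
  rw [hτ g hgc.measurable, ← Real.norm_eq_abs]
  have hWc := h.continuous_rescVort t
  have hi : Integrable fun y : ℝ × ℝ => g y.1 * rescVort ω t y :=
    ((hgc.comp continuous_fst).mul hWc).integrable_of_hasCompactSupport
      (h.hasCompactSupport_rescVort ht).mul_left
  refine norm_integral_le_of_norm_le hi.integrableOn ((ae_restrict_iff' hH).2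
    (Eventually.of_forall fun y hy => ?_))
  have hW0 := h.rescVort_nonneg h0 ht y
  rw [norm_mul, norm_mul, Real.norm_of_nonneg hW0]
  refine mul_le_mul_of_nonneg_right ?_ hW0
  refine mul_le_mul_of_nonneg_left ?_ (norm_nonneg _)
  have := abs_rescVel_fst_le h h0 ht hpq hq hN (hb0 y.1) hδ hN' hχ hχ0 hχ1 hχδ hy
  rw [hτ _ measurable_const, hτ (fun s' => χ (y.1 - s')) (by fun_prop)]
  simpa only [one_mul, mul_assoc, Real.norm_eq_abs] using this

lemma rescVort_eq_zero (h : IsEulerSol ω u) {p q : ℝ} (hpq : p.HolderConjugate q) (hq : q < 2)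
    (h0 : ∫ y, |ω 0 y| ^ p = 0) {t : ℝ} (ht : 0 ≤ t) (y : ℝ × ℝ) : rescVort ω t y = 0 := by
  rw [← h.integral_abs_rpow_eq hpq hq ht] at h0
  have hc : Continuous fun y => |ω t y| ^ p :=
    (h.continuous_slice t).abs.rpow_const fun _ => Or.inr hpq.nonneg
  have h1 := (integral_eq_zero_iff_of_nonneg (fun y => Real.rpow_nonneg (abs_nonneg _) _)
    (integrable_abs_rpow (h.continuous_slice t) (h.compactSupp t) hpq.pos)).1 h0
  have h2 := congrFun (hc.ae_eq_iff_eq volume continuous_zero |>.1 h1) (t • y)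
  simp only [Pi.zero_apply] at h2
  rw [rescVort, abs_eq_zero.1 ((Real.rpow_eq_zero (abs_nonneg _) hpq.ne_zero).1 h2), mul_zero]

lemma limsup_abs_integral_le (h : IsEulerSol ω u) (h0 : ∀ x, 0 ≤ ω 0 x) {p q : ℝ}
    (hpq : p.HolderConjugate q) (hq : q < 2) {tk : ℕ → ℝ} (htk : ∀ k, 0 < tk k)
    (htop : Tendsto tk atTop atTop) {μ ν : Measure ℝ} [IsFiniteMeasure μ] {A : Set ℝ} {m : ℝ → ℝ}
    (hA : A.Countable) (hν : ∀ x, ν {x} = 0) (hm : ∀ α ∈ A, 0 < m α)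
    (hμ : μ = ν + Measure.sum fun α : A => ENNReal.ofReal (m α) • Measure.dirac (α : ℝ))
    (hconv : ∀ φ : ℝ × ℝ → ℝ, Continuous φ → (∃ B, ∀ z, |φ z| ≤ B) →
      Tendsto (fun k => ∫ y in Hplane, φ y * rescVort ω (tk k) y) atTop (𝓝 (∫ s, φ (s, 0) ∂μ)))
    {ψ : ℝ → ℝ} (hψ : Continuous ψ) {B : ℝ} (hB : ∀ s, |ψ s| ≤ B) {N : ℝ} (hN : 0 < N)
    (hN' : ∫ y, |ω 0 y| ^ p ≤ N ^ p) :
    limsup (fun k =>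
      |∫ y in Hplane, ψ y.1 * ((rescVel u (tk k) y).1 / tk k) * rescVort ω (tk k) y|) atTop ≤
      2 * N ^ (q / 2) * (1 + (1 + ∫ z in ball (0 : ℝ × ℝ) 1, ‖z‖ ^ (-q))) *
        ∑' α : A, m α ^ (2 - q / 2) * |ψ α| := by
  have hq1 : 0 < q := hpq.symm.pos
  have hW : ∀ k, Integrable (rescVort ω (tk k)) (volume.restrict Hplane) := fun k =>
    ((h.continuous_rescVort _).integrable_of_hasCompactSupport
      (h.hasCompactSupport_rescVort (htk k))).integrableOn
  choose τ hτf hτ using fun k => exists_horizontal_marginal (hW k)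
    (h.rescVort_nonneg h0 (htk k)) (h.continuous_rescVort _).measurable
  have hweak : ∀ f : ℝ → ℝ, Continuous f → (∃ B, ∀ s, |f s| ≤ B) →
      Tendsto (fun k => ∫ s, f s ∂τ k) atTop (𝓝 (∫ s, f s ∂μ)) := by
    rintro f hf ⟨D, hD⟩
    simp only [hτ _ f hf.measurable]
    exact hconv (fun z => f z.1) (hf.comp continuous_fst) ⟨D, fun z => hD z.1⟩
  obtain ⟨χ, b, hχ, hχ0, hχ1, hχδ, hb, hbl, hbu, hχb, hblim⟩ := exists_bump_sequence μ
  have hδ : ∀ n : ℕ, (0 : ℝ) < 1 / ((n : ℝ) + 1) := fun n => by positivity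
  have hb0 : ∀ n s, 0 < b n s := fun n s => (hδ n).trans_le (hbl n s)
  obtain ⟨hi, hlim⟩ := tendsto_integral_mul_rpow (μ := μ) hψ hB (θ := 1 - q / 2) (by linarith) hb
    (fun n s => (hb0 n s).le) hbu hblim
  have hsum := integral_mul_rpow_measureReal_singleton hA hν hm hμ (by linarith) hi
  rw [show 1 + (1 - q / 2) = 2 - q / 2 by ring] at hsum
  rw [← hsum]
  refine ge_of_tendsto (hlim.const_mul _) (Eventually.of_forall fun n => ?_)
  have ha : Tendsto (fun k => (tk k)⁻¹ * (1 / ((n : ℝ) + 1))⁻¹) atTop (𝓝 0) := by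
    simpa using htop.inv_tendsto_atTop.mul_const (1 / ((n : ℝ) + 1))⁻¹
  obtain ⟨L, hL, hLim⟩ := exists_tendsto_averaged_bound hweak hψ hB (hχ n) (hχ0 n) (hχ1 n) (hb n)
    (hδ n) (hbl n) (hbu n) (hχb n) ha (K := N ^ (q / 2))
    (C := 1 + ∫ z in ball (0 : ℝ × ℝ) 1, ‖z‖ ^ (-q)) (r := q / 2) (by positivity) (by linarith)
    (by linarith)
  refine le_trans ?_ hL
  rw [← hLim.limsup_eq]
  refine limsup_le_limsup (Eventually.of_forall fun k => ?_)
    (isCoboundedUnder_le_of_le atTop (x := 0) fun k => abs_nonneg _) hLim.isBoundedUnder_le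
  exact h.abs_integral_mul_rescVel_le h0 (htk k) hpq hq hN (hδ n) hN' hψ (hχ n) (hχ0 n) (hχ1 n)
    (hχδ n) (hb n) (hb0 n) (hτ k)

end IsEulerSol

end

/-- Proposition 3.3 (the key estimate): if `ω̃(t_k,·) ⇀ μ ⊗ δ₀` with
`μ = ν + Σ_i m_i δ_{α_i}` (continuous part plus atoms `m_i > 0` at the distinct
points of the countable set `A`), then for every bounded continuous `ψ`,
`limsup_k |∫_ℍ ψ(y₁) (ũ₁(t_k,y)/t_k) ω̃(t_k,y) dy|
  ≤ D ‖ω₀‖_{Lᵖ}^{p'/2} Σ_i m_i^{2-p'/2} |ψ(α_i)|`, with `D = D(p) > 0`. -/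
theorem stmt_12 (p : ℝ) (hp : 2 < p) :
    ∃ D : ℝ, 0 < D ∧
      ∀ (ω : ℝ → ℝ × ℝ → ℝ) (u : ℝ → ℝ × ℝ → ℝ × ℝ),
        IsEulerSol ω u → (∀ x, 0 ≤ ω 0 x) →
        ∀ tk : ℕ → ℝ, (∀ k, 0 < tk k) → Tendsto tk atTop atTop →
        ∀ (μ : Measure ℝ), IsFiniteMeasure μ →
        ∀ (ν : Measure ℝ) (A : Set ℝ) (m : ℝ → ℝ),
          A.Countable →
          (∀ x : ℝ, ν {x} = 0) →
          (∀ α ∈ A, 0 < m α) →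
          μ = ν + Measure.sum (fun α : A => ENNReal.ofReal (m α) • Measure.dirac (α : ℝ)) →
          (∀ φ : ℝ × ℝ → ℝ, Continuous φ → (∃ B, ∀ z, |φ z| ≤ B) →
            Tendsto (fun k => ∫ y in Hplane, φ y * rescVort ω (tk k) y) atTop
              (nhds (∫ s, φ (s, 0) ∂μ))) →
          ∀ ψ : ℝ → ℝ, Continuous ψ → (∃ B, ∀ s, |ψ s| ≤ B) →
            limsup (fun k =>
                |∫ y in Hplane,
                  ψ y.1 * ((rescVel u (tk k) y).1 / tk k) * rescVort ω (tk k) y|) atTop ≤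
              D * ((∫ y in Hplane, |ω 0 y| ^ p) ^ (1 / p)) ^ ((p / (p - 1)) / 2) *
                ∑' α : A, m α ^ (2 - (p / (p - 1)) / 2) * |ψ α| := by
  obtain ⟨hp0, hp1⟩ : 0 < p ∧ 0 < p - 1 := ⟨by linarith, by linarith⟩
  have hpq : p.HolderConjugate (p / (p - 1)) := Real.HolderConjugate.conjExponent (by linarith)
  have hq : p / (p - 1) < 2 := by rw [div_lt_iff₀ hp1]; linarith
  generalize p / (p - 1) = q at hpq hq ⊢
  have hC : 0 ≤ ∫ z in Metric.ball (0 : ℝ × ℝ) 1, ‖z‖ ^ (-q) :=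
    integral_nonneg fun z => Real.rpow_nonneg (norm_nonneg _) _
  refine ⟨2 * (1 + (1 + ∫ z in Metric.ball (0 : ℝ × ℝ) 1, ‖z‖ ^ (-q))), by linarith, ?_⟩
  intro ω u h h0 tk htk htop μ _ ν A m hA hν hm hμ hconv ψ hψ ⟨B, hB⟩
  have hωp : ∫ y in Hplane, |ω 0 y| ^ p = ∫ y, |ω 0 y| ^ p := by
    refine setIntegral_eq_integral_of_forall_compl_eq_zero fun y hy => ?_
    rw [h.eq_zero_of_notMem 0 hy, abs_zero, Real.zero_rpow hp0.ne']
  have hI : 0 ≤ ∫ y, |ω 0 y| ^ p := integral_nonneg fun y => Real.rpow_nonneg (abs_nonneg _) _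
  rw [hωp]
  rcases hI.eq_or_lt with hI0 | hI0
  · have hz : ∀ k y, rescVort ω (tk k) y = 0 := fun k =>
      h.rescVort_eq_zero hpq hq hI0.symm (htk k).le
    simp only [hz, mul_zero, integral_zero, abs_zero, limsup_const]
    have hS : 0 ≤ ∑' α : A, m α ^ (2 - q / 2) * |ψ α| := tsum_nonneg fun α =>
      mul_nonneg (Real.rpow_nonneg (hm α α.2).le _) (abs_nonneg _)
    positivity
  · have hN' : ∫ y, |ω 0 y| ^ p ≤ ((∫ y, |ω 0 y| ^ p) ^ (1 / p)) ^ p := by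
      rw [← Real.rpow_mul hI, one_div, inv_mul_cancel₀ hp0.ne', Real.rpow_one]
    refine (h.limsup_abs_integral_le h0 hpq hq htk htop hA hν hm hμ hconv hψ hB
      (Real.rpow_pos_of_pos hI0 (1 / p)) hN').trans_eq ?_
    ring
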